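/- arXiv:1205.1924 — 8 statements merged into one kernel-verified Lean document; each statement's English description precedes it below -/
import Mathlib

section
/- For every tree T on n ≥ 1 vertices there exists a tree decomposition H of T with pivot size at most 2 and depth at most 2⌈log₂ n⌉ + 2. -/
open SimpleGraph

/-- `w` lies on every path between `a` and `b` in `G` (in a tree: on *the* unique path). -/
def OnPath {V : Type*} (G : SimpleGraph V) (a b w : V) : Prop :=
  ∀ p : G.Walk a b, p.IsPath → w ∈ p.support

/-- In the tree `H` rooted at `g`, `y` is an ancestor of `x`. -/
def IsAncestor {V : Type*} (H : SimpleGraph V) (g y x : V) : Prop :=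
  y ≠ x ∧ OnPath H g x y

/-- `C(z)`: the set consisting of `z` together with all its descendants in `H` rooted at `g`. -/
def descSet {V : Type*} (H : SimpleGraph V) (g z : V) : Set V :=
  {x | x = z ∨ IsAncestor H g z x}

/-- Depth of `x` in `H` rooted at `g`: number of nodes on the path from `g` to `x`. -/
noncomputable def depthIn {V : Type*} (H : SimpleGraph V) (g x : V) : ℕ :=
  H.dist g x + 1

/-- `w` is a least common ancestor of `x` and `y` in `H` rooted at `g`. -/
def IsLCA {V : Type*} (H : SimpleGraph V) (g x y w : V) : Prop :=
  OnPath H g x w ∧ OnPath H g y w ∧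
    ∀ w' : V, OnPath H g x w' → OnPath H g y w' → depthIn H g w' ≤ depthIn H g w

/-- `C` is a component of `T`: the induced subgraph is connected. -/
def IsComp {V : Type*} (T : SimpleGraph V) (C : Set V) : Prop :=
  (T.induce C).Connected

/-- The neighborhood `Γ[C]`: vertices outside `C` adjacent in `T` to some vertex of `C`. -/
def nbhd {V : Type*} (T : SimpleGraph V) (C : Set V) : Set V :=
  {x | x ∉ C ∧ ∃ y ∈ C, T.Adj x y}

section OnPath

variable {V : Type*} {T : SimpleGraph V} {a b c w x y z : V}

/-- A vertex lies on every path from `a` to `b` iff it lies on every walk from `a` to `b`. -/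
theorem onPath_iff_forall_walk : OnPath T a b w ↔ ∀ p : T.Walk a b, w ∈ p.support := by
  classical
  exact ⟨fun h p => p.support_bypass_subset_support (h _ p.bypass_isPath), fun h p _ => h p⟩

theorem OnPath.symm (h : OnPath T a b w) : OnPath T b a w := by
  intro p hp
  simpa using h p.reverse hp.reverse

theorem onPath_left (a b : V) : OnPath T a b a := fun p _ => p.start_mem_support

theorem onPath_right (a b : V) : OnPath T a b b := fun p _ => p.end_mem_support

theorem OnPath.eq_of_self (h : OnPath T a a w) : w = a := by
  simpa using h Walk.nil Walk.IsPath.nil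

theorem OnPath.or_of_via (h : OnPath T x y z) (w : V) : OnPath T x w z ∨ OnPath T w y z := by
  simp only [onPath_iff_forall_walk] at *
  by_contra! hc
  obtain ⟨⟨p, hp⟩, q, hq⟩ := hc
  have := h (p.append q)
  simp [Walk.mem_support_append_iff, hp, hq] at this

theorem OnPath.trans (h : OnPath T a b w) (h' : OnPath T a w z) : OnPath T a b z := by
  classical
  intro p hp
  exact p.support_takeUntil_subset_support (h p hp) (h' _ (hp.takeUntil (h p hp)))

theorem onPath_of_isPath (hT : T.IsTree) {p : T.Walk a b} (hp : p.IsPath) (hw : w ∈ p.support) :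
    OnPath T a b w := by
  intro q hq
  have := congrArg Subtype.val ((hT.isAcyclic.subsingleton_path a b).elim ⟨p, hp⟩ ⟨q, hq⟩)
  simp only at this
  rwa [← this]

theorem onPath_cons (hT : T.IsTree) (h : T.Adj a c) (hc : ¬ OnPath T c b a) : OnPath T a b c := by
  simp only [OnPath, not_forall] at hc
  obtain ⟨p, hp, hap⟩ := hc
  exact onPath_of_isPath hT (hp.cons hap : (Walk.cons h p).IsPath) (by simp)

theorem OnPath.of_adj (h : OnPath T a b w) (hab : T.Adj a b) : w = a ∨ w = b := by
  simpa using onPath_iff_forall_walk.1 h (Walk.cons hab Walk.nil)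

theorem OnPath.dist_lt (hT : T.IsTree) (h : OnPath T a b w) (hw : T.Adj a w) :
    T.dist w b < T.dist a b := by
  classical
  obtain ⟨p, hp⟩ := hT.connected.exists_walk_length_eq_dist a b
  have hwp := onPath_iff_forall_walk.1 h p
  have h1 := congrArg Walk.length (p.take_spec hwp)
  rw [Walk.length_append] at h1
  have h2 := dist_le (p.dropUntil w hwp)
  have h3 := dist_le (p.takeUntil w hwp)
  rw [dist_eq_one_iff_adj.2 hw] at h3
  omega

theorem exists_adj_onPath (hT : T.IsTree) (hab : a ≠ b) : ∃ c, T.Adj a c ∧ OnPath T a b c := by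
  obtain ⟨p, hp⟩ := (hT.connected a b).exists_isPath
  cases p with
  | nil => exact absurd rfl hab
  | cons h q => exact ⟨_, h, onPath_of_isPath hT hp (by simp)⟩

theorem onPath_of_adj_of_adj (hT : T.IsTree) (ha : T.Adj a w) (hb : T.Adj w b) (hab : a ≠ b) :
    OnPath T a b w := by
  refine onPath_of_isPath hT (p := Walk.cons ha (Walk.cons hb Walk.nil)) ?_ (by simp)
  simp [Walk.cons_isPath_iff, ha.ne, hb.ne, hab]

/-- Any three vertices of a tree have a median. -/
theorem exists_median (hT : T.IsTree) (a b c : V) :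
    ∃ m, OnPath T a b m ∧ OnPath T a c m ∧ OnPath T b c m := by
  classical
  obtain ⟨m, ⟨hma, hmb⟩, hmin⟩ := exists_minimalFor_of_wellFoundedLT
    (fun m => OnPath T a c m ∧ OnPath T b c m) (fun m => T.dist m a)
    ⟨c, onPath_right _ _, onPath_right _ _⟩
  refine ⟨m, ?_, hma, hmb⟩
  by_contra hab
  have hne : m ≠ a := fun h => hab (h ▸ onPath_left _ _)
  obtain ⟨m', hadj, hm'⟩ := exists_adj_onPath hT hne
  have hlt := hm'.dist_lt hT hadj
  have ham : ¬ OnPath T m' a m := by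
    intro h
    exact lt_asymm hlt (h.dist_lt hT hadj.symm)
  have hbm : ¬ OnPath T m' b m := fun h => (h.or_of_via a).elim ham hab
  have hm'b := onPath_cons hT hadj hbm
  exact hlt.not_ge (hmin ⟨hma.trans hm'.symm, hmb.trans hm'b.symm⟩ hlt.le)

end OnPath

section Side

variable {V : Type*} {T : SimpleGraph V} {C : Finset V} {c x y z : V}

/-- `C` contains every path of `T` between two of its vertices. -/
def IsPathConvex (T : SimpleGraph V) (C : Finset V) : Prop :=
  ∀ a ∈ C, ∀ b ∈ C, ∀ w, OnPath T a b w → w ∈ C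

open Classical in
/-- The vertices of `C` in the same connected component as `x` after removing `z`. -/
noncomputable def side (T : SimpleGraph V) (C : Finset V) (z x : V) : Finset V :=
  {y ∈ C | ¬ OnPath T x y z}

theorem mem_side : y ∈ side T C z x ↔ y ∈ C ∧ ¬ OnPath T x y z := by
  simp [side]

theorem side_subset : side T C z x ⊆ C := fun _ h => (mem_side.1 h).1

theorem notMem_side : z ∉ side T C z x := fun h => (mem_side.1 h).2 (onPath_right _ _)

theorem self_mem_side (hx : x ∈ C) (h : x ≠ z) : x ∈ side T C z x :=
  mem_side.2 ⟨hx, fun h' => h h'.eq_of_self.symm⟩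

theorem side_eq_of_mem (hy : y ∈ side T C z x) : side T C z y = side T C z x := by
  have hxy := (mem_side.1 hy).2
  ext w
  simp only [mem_side, and_congr_right_iff, not_iff_not]
  exact fun _ => ⟨fun h => (h.or_of_via x).elim (fun h' => absurd h'.symm hxy) id,
    fun h => (h.or_of_via y).elim (fun h' => absurd h' hxy) id⟩

theorem IsPathConvex.convex_side (hC : IsPathConvex T C) (z x : V) :
    IsPathConvex T (side T C z x) := by
  intro a ha b hb w hw
  rw [mem_side] at *
  refine ⟨hC a ha.1 b hb.1 w hw, fun h => ?_⟩
  have haw : OnPath T a w z := (h.or_of_via a).resolve_left ha.2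
  exact ((hw.trans haw).or_of_via x).elim (fun h' => ha.2 h'.symm) hb.2

theorem nbhd_side_subset : nbhd T (side T C z x : Set V) ⊆ insert z (nbhd T (C : Set V)) := by
  rintro v ⟨hv, y, hy, hvy⟩
  simp only [Finset.mem_coe] at hv hy
  by_cases hvC : v ∈ C
  · left
    have hv' : OnPath T x v z := by
      by_contra h
      exact hv (mem_side.2 ⟨hvC, h⟩)
    rw [mem_side] at hy
    rcases ((hv'.or_of_via y).resolve_left hy.2).of_adj hvy.symm with rfl | rfl
    · exact absurd (onPath_right _ _) hy.2
    · rfl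
  · exact Or.inr ⟨hvC, y, side_subset hy, hvy⟩

theorem IsPathConvex.isComp (hT : T.IsTree) (hC : IsPathConvex T C) (hne : C.Nonempty) :
    IsComp T (C : Set V) := by
  obtain ⟨x, hx⟩ := hne
  have : Nonempty (C : Set V) := ⟨⟨x, hx⟩⟩
  refine ⟨fun a b => ?_⟩
  obtain ⟨p, hp⟩ := (hT.connected a.1 b.1).exists_isPath
  exact ⟨p.induce (C : Set V) fun w hw => hC _ a.2 _ b.2 w (onPath_of_isPath hT hp hw)⟩

/-- Every nonempty path-convex set of vertices of a tree has a centroid. -/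
theorem IsPathConvex.exists_centroid (hT : T.IsTree) (hC : IsPathConvex T C) (hne : C.Nonempty) :
    ∃ c ∈ C, ∀ x ∈ C, x ≠ c → 2 * (side T C c x).card ≤ C.card := by
  classical
  obtain ⟨c, hc, hmin⟩ := C.exists_min_image (fun c => ∑ y ∈ C, T.dist c y) hne
  refine ⟨c, hc, fun x hx hxc => ?_⟩
  obtain ⟨c', hadj, hc'⟩ := exists_adj_onPath hT hxc.symm
  have hle := hmin c' (hC c hc x hx c' hc')
  have hK : ∀ y ∈ side T C c x, T.dist c' y + 1 ≤ T.dist c y := by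
    intro y hy
    have hxy := (mem_side.1 hy).2
    refine (onPath_cons hT hadj fun h => ?_).dist_lt hT hadj
    rcases h.or_of_via x with h | h
    · exact lt_asymm (hc'.dist_lt hT hadj) (h.dist_lt hT hadj.symm)
    · exact hxy h
  have hK' : ∀ y ∈ C \ side T C c x, T.dist c' y ≤ T.dist c y + 1 := by
    intro y _
    have := hT.connected.dist_triangle (u := c') (v := c) (w := y)
    rw [dist_eq_one_iff_adj.2 hadj.symm] at this
    omega
  have h1 := Finset.sum_le_sum hK
  have h2 := Finset.sum_le_sum hK'
  rw [← Finset.sum_sdiff (side_subset : side T C c x ⊆ C),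
    ← Finset.sum_sdiff (side_subset : side T C c x ⊆ C)] at hle
  simp only [Finset.sum_add_distrib, Finset.sum_const, smul_eq_mul, mul_one] at h1 h2
  have h3 := Finset.card_sdiff_add_card_eq_card (side_subset : side T C c x ⊆ C)
  omega

theorem IsPathConvex.eq_of_adj_of_adj (hT : T.IsTree) (hC : IsPathConvex T C) {u a b : V}
    (hu : u ∉ C) (ha : a ∈ C) (hb : b ∈ C) (hua : T.Adj u a) (hub : T.Adj u b) : a = b := by
  by_contra hab
  exact hu (hC a ha b hb u (onPath_of_adj_of_adj hT hua.symm hub hab))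

/-- A nonempty vertex set of a tree that is connected and has at most two neighbours. -/
structure IsPiece (T : SimpleGraph V) (C : Finset V) : Prop where
  nonempty : C.Nonempty
  convex : IsPathConvex T C
  ncard_nbhd : (nbhd T (C : Set V)).ncard ≤ 2

open Classical in
/-- An upper bound for the height of a good elimination tree on the piece `C`. -/
noncomputable def heightBound (T : SimpleGraph V) (C : Finset V) : ℕ :=
  2 * Nat.log 2 C.card + if (nbhd T (C : Set V)).ncard ≤ 1 then 0 else 1

theorem heightBound_side_lt_of_card (hne : (side T C z x).Nonempty)
    (h : 2 * (side T C z x).card ≤ C.card) :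
    heightBound T (side T C z x) < heightBound T C := by
  have hpos := hne.card_pos
  have h1 : Nat.log 2 ((side T C z x).card * 2) ≤ Nat.log 2 C.card := Nat.log_mono_right (by omega)
  rw [Nat.log_mul_base (by norm_num) hpos.ne'] at h1
  unfold heightBound
  split_ifs <;> omega

theorem heightBound_side_lt_of_nbhd (hK : (nbhd T (side T C z x : Set V)).ncard ≤ 1)
    (hC : 1 < (nbhd T (C : Set V)).ncard) :
    heightBound T (side T C z x) < heightBound T C := by
  have h1 : Nat.log 2 (side T C z x).card ≤ Nat.log 2 C.card :=
    Nat.log_mono_right (Finset.card_le_card side_subset)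
  unfold heightBound
  rw [if_pos hK, if_neg (by omega)]
  omega

theorem IsPiece.exists_pivot [Finite V] (hT : T.IsTree) (hC : IsPiece T C) :
    ∃ z ∈ C, ∀ x ∈ C, x ≠ z →
      IsPiece T (side T C z x) ∧ heightBound T (side T C z x) < heightBound T C := by
  obtain ⟨c, hc, hcent⟩ := hC.convex.exists_centroid hT hC.nonempty
  by_cases h1 : (nbhd T (C : Set V)).ncard ≤ 1
  · refine ⟨c, hc, fun x hx hxc => ?_⟩
    have hne : (side T C c x).Nonempty := ⟨x, self_mem_side hx hxc⟩
    refine ⟨⟨hne, hC.convex.convex_side _ _, ?_⟩, heightBound_side_lt_of_card hne (hcent x hx hxc)⟩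
    have := Set.ncard_le_ncard (nbhd_side_subset (T := T) (C := C) (z := c) (x := x))
    have := Set.ncard_insert_le c (nbhd T (C : Set V))
    omega
  · obtain ⟨u, v, huv, hN⟩ := Set.ncard_eq_two.1 (le_antisymm hC.ncard_nbhd (by omega))
    obtain ⟨hu, a, ha, hua⟩ : u ∈ nbhd T (C : Set V) := by simp [hN]
    obtain ⟨hv, b, hb, hvb⟩ : v ∈ nbhd T (C : Set V) := by simp [hN]
    obtain ⟨m, hab, hac, hbc⟩ := exists_median hT a b c
    refine ⟨m, hC.convex a ha b hb m hab, fun x hx hxm => ?_⟩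
    have hne : (side T C m x).Nonempty := ⟨x, self_mem_side hx hxm⟩
    have hsub := nbhd_side_subset (T := T) (C := C) (z := m) (x := x)
    have sep : ∀ {s t}, OnPath T s t m → s ∈ side T C m x → t ∉ side T C m x := by
      intro s t hst hs ht
      exact (hst.or_of_via x).elim (fun h => (mem_side.1 hs).2 h.symm) (mem_side.1 ht).2
    have key : ∀ {u a}, u ∉ C → a ∈ C → T.Adj u a → u ∈ nbhd T (side T C m x : Set V) →
        a ∈ side T C m x := by
      rintro u a hu ha hua ⟨-, y, hy, huy⟩
      rwa [hC.convex.eq_of_adj_of_adj hT hu ha (side_subset hy) hua huy]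
    have hua' := key hu ha hua
    have hvb' := key hv hb hvb
    rw [hN] at hsub
    have hcard : (nbhd T (side T C m x : Set V)).ncard ≤ 2 := by
      by_cases hu' : u ∈ nbhd T (side T C m x : Set V)
      · refine (Set.ncard_le_ncard (t := {m, u}) fun w hw => ?_).trans
          ((Set.ncard_insert_le _ _).trans (by simp))
        rcases hsub hw with rfl | rfl | rfl
        · simp
        · simp
        · exact absurd (hvb' hw) (sep hab (hua' hu'))
      · refine (Set.ncard_le_ncard (t := {m, v}) fun w hw => ?_).trans
          ((Set.ncard_insert_le _ _).trans (by simp))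
        rcases hsub hw with rfl | rfl | rfl
        · simp
        · exact absurd hw hu'
        · simp
    refine ⟨⟨hne, hC.convex.convex_side _ _, hcard⟩, ?_⟩
    by_cases hcK : c ∈ side T C m x
    · refine heightBound_side_lt_of_nbhd ?_ (by omega)
      refine (Set.ncard_le_ncard (t := {m}) fun w hw => ?_).trans (Set.ncard_singleton _).le
      rcases hsub hw with rfl | rfl | rfl
      · rfl
      · exact absurd hcK (sep hac (hua' hw))
      · exact absurd hcK (sep hbc (hvb' hw))
    · have hxc : OnPath T x c m := by
        by_contra h
        exact hcK (mem_side.2 ⟨hc, h⟩)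
      refine heightBound_side_lt_of_card hne ?_
      have hxc' : x ≠ c := by
        rintro rfl
        exact hcK (self_mem_side hx hxm)
      refine le_trans (Nat.mul_le_mul_left 2 (Finset.card_le_card fun y hy => ?_)) (hcent x hx hxc')
      rw [mem_side] at hy ⊢
      exact ⟨hy.1, fun h => hy.2 (h.trans hxc)⟩

end Side

section Hierarchy

variable {V : Type*}

/-- A rooted tree given by the depth `d x` of each vertex and its ancestor `a x i` at each
depth `i ≤ d x`. -/
structure IsHierarchy (g : V) (d : V → ℕ) (a : V → ℕ → V) : Prop where
  root : ∀ x, a x 0 = g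
  self : ∀ x, a x (d x) = x
  depth : ∀ x, ∀ i ≤ d x, d (a x i) = i
  trans : ∀ x, ∀ i ≤ d x, ∀ j ≤ i, a (a x i) j = a x j

/-- `y` is a child of `x`. -/
def IsChild (d : V → ℕ) (a : V → ℕ → V) (x y : V) : Prop :=
  d y = d x + 1 ∧ a y (d x) = x

/-- The graph joining each vertex to its parent. -/
def hierarchyGraph (d : V → ℕ) (a : V → ℕ → V) : SimpleGraph V where
  Adj x y := IsChild d a x y ∨ IsChild d a y x
  symm := ⟨fun _ _ => Or.symm⟩
  loopless := ⟨fun x h => by simp [IsChild] at h⟩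

namespace IsHierarchy

variable {g : V} {d : V → ℕ} {a : V → ℕ → V} {u v w x : V}

theorem anc_iff_of_isChild (h : IsHierarchy g d a) (huv : IsChild d a u v) (hw : w ≠ v) :
    (d w ≤ d u ∧ a u (d w) = w) ↔ (d w ≤ d v ∧ a v (d w) = w) := by
  have hd := huv.1
  have key : ∀ i ≤ d u, a u i = a v i := by
    intro i hi
    have := h.trans v (d u) (by omega) i hi
    rwa [huv.2] at this
  constructor
  · rintro ⟨h1, h2⟩
    exact ⟨by omega, by rw [← key _ h1, h2]⟩
  · rintro ⟨h1, h2⟩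
    have h3 : d w ≤ d u := by
      by_contra h3
      have : d w = d v := by omega
      rw [this, h.self] at h2
      exact hw h2.symm
    exact ⟨h3, by rw [key _ h3, h2]⟩

theorem anc_iff_of_walk (h : IsHierarchy g d a) (p : (hierarchyGraph d a).Walk u v)
    (hw : w ∉ p.support) : (d w ≤ d u ∧ a u (d w) = w) ↔ (d w ≤ d v ∧ a v (d w) = w) := by
  induction p with
  | nil => rfl
  | cons hadj q ih =>
    simp only [Walk.support_cons, List.mem_cons, not_or] at hw
    rw [← ih hw.2]
    rcases hadj with hc | hc
    · exact h.anc_iff_of_isChild hc fun e => hw.2 (e ▸ q.start_mem_support)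
    · exact (h.anc_iff_of_isChild hc hw.1).symm

theorem exists_walk (h : IsHierarchy g d a) (x : V) :
    ∃ p : (hierarchyGraph d a).Walk g x, p.length = d x ∧
      ∀ w ∈ p.support, d w ≤ d x ∧ a x (d w) = w := by
  induction hn : d x generalizing x with
  | zero =>
    have hx : g = x := by rw [← h.root x, ← hn, h.self]
    subst hx
    refine ⟨Walk.nil, rfl, ?_⟩
    simp [hn, h.root]
  | succ n ih =>
    have hd := h.depth x n (by omega)
    obtain ⟨p, hp, hs⟩ := ih (a x n) hd
    have hadj : (hierarchyGraph d a).Adj (a x n) x := Or.inl ⟨by omega, by rw [hd]⟩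
    refine ⟨p.concat hadj, by simp [hp], fun w hw => ?_⟩
    rw [Walk.support_concat, List.mem_append, List.mem_singleton] at hw
    rcases hw with hw | rfl
    · obtain ⟨h1, h2⟩ := hs w hw
      rw [h.trans x n (by omega) _ h1] at h2
      exact ⟨by omega, h2⟩
    · exact ⟨hn.le, h.self w⟩

theorem onPath_iff (h : IsHierarchy g d a) :
    OnPath (hierarchyGraph d a) g x w ↔ d w ≤ d x ∧ a x (d w) = w := by
  rw [onPath_iff_forall_walk]
  constructor
  · intro hw
    obtain ⟨p, -, hp⟩ := h.exists_walk x
    exact hp w (hw p)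
  · intro hw p
    by_contra hwp
    obtain ⟨h1, h2⟩ := (h.anc_iff_of_walk p hwp).2 hw
    have h0 : d g = 0 := by rw [← h.root x, h.depth x 0 (Nat.zero_le _)]
    rw [h0, Nat.le_zero] at h1
    rw [h1, h.root] at h2
    exact hwp (h2 ▸ p.start_mem_support)

theorem dist_eq (h : IsHierarchy g d a) (x : V) : (hierarchyGraph d a).dist g x = d x := by
  obtain ⟨p, hp, -⟩ := h.exists_walk x
  refine le_antisymm (hp ▸ dist_le p) ?_
  obtain ⟨q, hq⟩ := p.reachable.exists_walk_length_eq_dist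
  have key : ∀ {u v} (q : (hierarchyGraph d a).Walk u v), d v ≤ d u + q.length := by
    intro u v q
    induction q with
    | nil => simp
    | cons hadj q ih =>
      rw [Walk.length_cons]
      rcases hadj with hc | hc <;> have := hc.1 <;> omega
  have h0 : d g = 0 := by rw [← h.root x, h.depth x 0 (Nat.zero_le _)]
  have := key q
  omega

theorem mem_edges (h : IsHierarchy g d a) {t : V} (htv : IsChild d a t v)
    (p : (hierarchyGraph d a).Walk u w) (hu : ¬ (d v ≤ d u ∧ a u (d v) = v))
    (hw : d v ≤ d w ∧ a w (d v) = v) : s(t, v) ∈ p.edges := by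
  induction p with
  | nil => exact absurd hw hu
  | @cons u u' w hadj q ih =>
    rw [Walk.edges_cons, List.mem_cons]
    by_cases hu' : d v ≤ d u' ∧ a u' (d v) = v
    · left
      rcases hadj with hc | hc
      · have hv : v = u' := by
          by_contra hv
          exact hu ((h.anc_iff_of_isChild hc hv).2 hu')
        subst hv
        have : d t = d u := by have := htv.1; have := hc.1; omega
        rw [← htv.2, this, hc.2]
      · have hv : v ≠ u := by
          rintro rfl
          exact hu ⟨le_rfl, h.self _⟩
        exact absurd ((h.anc_iff_of_isChild hc hv).1 hu') hu
    · exact Or.inr (ih hu' hw)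

theorem isTree [Nonempty V] (h : IsHierarchy g d a) : (hierarchyGraph d a).IsTree := by
  refine ⟨⟨fun x y => ?_⟩, ?_⟩
  · obtain ⟨p, -⟩ := h.exists_walk x
    obtain ⟨q, -⟩ := h.exists_walk y
    exact p.reachable.symm.trans q.reachable
  · have key : ∀ {u v}, IsChild d a u v → (hierarchyGraph d a).IsBridge s(u, v) := by
      intro u v huv
      rw [isBridge_iff_forall_walk_mem_edges]
      intro p
      exact h.mem_edges huv p (fun h' => by have := huv.1; omega) ⟨le_rfl, h.self v⟩
    rw [isAcyclic_iff_forall_isBridge]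
    intro e
    induction e with
    | h u v =>
      rintro (huv | huv)
      · exact key huv
      · rw [Sym2.eq_swap]
        exact key huv

end IsHierarchy

end Hierarchy

section Branch

variable {V : Type*} [Fintype V] {T : SimpleGraph V} {f : Finset V → V} {x y : V} {i : ℕ}

/-- `f` selects in every piece `C` a vertex whose removal leaves pieces of smaller height bound. -/
def IsPivotRule (T : SimpleGraph V) (f : Finset V → V) : Prop :=
  ∀ C, IsPiece T C → f C ∈ C ∧ ∀ x ∈ C, x ≠ f C →
    IsPiece T (side T C (f C) x) ∧ heightBound T (side T C (f C) x) < heightBound T C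

theorem exists_isPivotRule (hT : T.IsTree) : ∃ f, IsPivotRule T f := by
  have hx := hT.connected.nonempty
  have : ∀ C, ∃ z, IsPiece T C → z ∈ C ∧ ∀ x ∈ C, x ≠ z →
      IsPiece T (side T C z x) ∧ heightBound T (side T C z x) < heightBound T C := by
    intro C
    by_cases hC : IsPiece T C
    · obtain ⟨z, hz⟩ := hC.exists_pivot hT
      exact ⟨z, fun _ => hz⟩
    · exact ⟨hx.some, fun h => absurd h hC⟩
  choose f hf using this
  exact ⟨f, hf⟩

/-- The successive pieces containing `x` when pivots are removed according to the rule `f`. -/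
noncomputable def branch (T : SimpleGraph V) (f : Finset V → V) (x : V) : ℕ → Finset V
  | 0 => Finset.univ
  | i + 1 => side T (branch T f x i) (f (branch T f x i)) x

/-- The first step at which `x` is selected as a pivot. -/
noncomputable def level (T : SimpleGraph V) (f : Finset V → V) (x : V) : ℕ :=
  sInf {i | f (branch T f x i) = x}

theorem branch_antitone : Antitone (branch T f x) :=
  antitone_nat_of_succ_le fun _ => side_subset

theorem branch_eq_of_mem (hy : y ∈ branch T f x i) {j : ℕ} (hj : j ≤ i) :
    branch T f y j = branch T f x j := by
  induction j with
  | zero => rfl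
  | succ j ih =>
    have hy' := branch_antitone hj hy
    rw [branch] at hy' ⊢
    rw [ih (by omega), side_eq_of_mem hy', branch]

theorem isPiece_univ [Nonempty V] : IsPiece T Finset.univ :=
  ⟨Finset.univ_nonempty, fun _ _ _ _ w _ => Finset.mem_univ w, by simp [nbhd]⟩

theorem heightBound_univ : heightBound T Finset.univ = 2 * Nat.log 2 (Fintype.card V) := by
  simp [heightBound, nbhd]

theorem IsPivotRule.branch_spec (hf : IsPivotRule T f) (h : ∀ j < i, f (branch T f x j) ≠ x) :
    IsPiece T (branch T f x i) ∧ x ∈ branch T f x i ∧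
      heightBound T (branch T f x i) + i ≤ heightBound T Finset.univ := by
  induction i with
  | zero =>
    have : Nonempty V := ⟨x⟩
    exact ⟨isPiece_univ, Finset.mem_univ x, le_rfl⟩
  | succ i ih =>
    obtain ⟨h1, h2, h3⟩ := ih fun j hj => h j (by omega)
    have hx := (h i (by omega)).symm
    obtain ⟨h4, h5⟩ := (hf _ h1).2 x h2 hx
    exact ⟨h4, self_mem_side h2 hx, by rw [branch]; omega⟩

theorem IsPivotRule.apply_branch_level (hf : IsPivotRule T f) (x : V) :
    f (branch T f x (level T f x)) = x := by
  refine Nat.sInf_mem (s := {i | f (branch T f x i) = x}) ?_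
  by_contra hne
  rw [Set.not_nonempty_iff_eq_empty, Set.eq_empty_iff_forall_notMem] at hne
  have := (hf.branch_spec (x := x) (i := heightBound T Finset.univ + 1) fun j _ => hne j).2.2
  omega

theorem apply_branch_ne_of_lt_level (h : i < level T f x) : f (branch T f x i) ≠ x :=
  Nat.notMem_of_lt_sInf h

theorem IsPivotRule.branch_spec_of_le_level (hf : IsPivotRule T f) (h : i ≤ level T f x) :
    IsPiece T (branch T f x i) ∧ x ∈ branch T f x i ∧
      heightBound T (branch T f x i) + i ≤ heightBound T Finset.univ :=
  hf.branch_spec fun _ hj => apply_branch_ne_of_lt_level (hj.trans_le h)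

theorem IsPivotRule.pivot_mem (hf : IsPivotRule T f) (h : i ≤ level T f x) :
    f (branch T f x i) ∈ branch T f x i :=
  (hf _ (hf.branch_spec_of_le_level h).1).1

theorem IsPivotRule.le_level_of_mem (hf : IsPivotRule T f) (hy : y ∈ branch T f x i) :
    i ≤ level T f y := by
  by_contra! hlt
  have h1 := hf.apply_branch_level y
  have h2 := branch_antitone (Nat.succ_le_of_lt hlt) hy
  rw [branch_eq_of_mem hy hlt.le] at h1
  rw [Nat.succ_eq_add_one, branch, h1] at h2
  exact notMem_side h2

theorem IsPivotRule.isHierarchy (hf : IsPivotRule T f) :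
    IsHierarchy (f Finset.univ) (level T f) fun x i => f (branch T f x i) where
  root _ := rfl
  self := hf.apply_branch_level
  depth x i hi := by
    have hmem := hf.pivot_mem hi
    refine le_antisymm (Nat.sInf_le ?_) (hf.le_level_of_mem hmem)
    rw [Set.mem_ofPred_eq, branch_eq_of_mem hmem le_rfl]
  trans x i hi j hj := by
    rw [branch_eq_of_mem (hf.pivot_mem hi) hj]

/-- The elimination tree of the pivot rule `f`. -/
noncomputable def eliminationTree (T : SimpleGraph V) (f : Finset V → V) : SimpleGraph V :=
  hierarchyGraph (level T f) fun x i => f (branch T f x i)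

theorem IsPivotRule.onPath_iff (hf : IsPivotRule T f) :
    OnPath (eliminationTree T f) (f Finset.univ) x y ↔ x ∈ branch T f y (level T f y) := by
  rw [eliminationTree, hf.isHierarchy.onPath_iff]
  constructor
  · rintro ⟨h1, h2⟩
    have hmem := hf.pivot_mem h1
    rw [h2] at hmem
    rw [branch_eq_of_mem hmem le_rfl]
    exact (hf.branch_spec_of_le_level h1).2.1
  · intro h
    refine ⟨hf.le_level_of_mem h, ?_⟩
    rw [branch_eq_of_mem h le_rfl, hf.apply_branch_level]

theorem IsPivotRule.descSet_eq (hf : IsPivotRule T f) (z : V) :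
    descSet (eliminationTree T f) (f Finset.univ) z = branch T f z (level T f z) := by
  ext x
  simp only [descSet, IsAncestor, Set.mem_ofPred_eq, hf.onPath_iff, Finset.mem_coe]
  constructor
  · rintro (rfl | h)
    · exact (hf.branch_spec_of_le_level le_rfl).2.1
    · exact h.2
  · intro h
    by_cases hz : x = z
    · exact Or.inl hz
    · exact Or.inr ⟨Ne.symm hz, h⟩

theorem IsPivotRule.depthIn_eq (hf : IsPivotRule T f) (x : V) :
    depthIn (eliminationTree T f) (f Finset.univ) x = level T f x + 1 := by
  rw [depthIn, eliminationTree, hf.isHierarchy.dist_eq]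

theorem IsPivotRule.onPath_of_isLCA (hf : IsPivotRule T f) {w : V}
    (h : IsLCA (eliminationTree T f) (f Finset.univ) x y w) : OnPath T x y w := by
  obtain ⟨hx, hy, hmax⟩ := h
  rw [hf.onPath_iff] at hx hy
  by_contra hxy
  have hw := hf.apply_branch_level w
  have hxw : x ≠ w := by
    rintro rfl
    exact hxy (onPath_left _ _)
  have hbx := branch_eq_of_mem hx le_rfl
  have hlx : level T f w + 1 ≤ level T f x := by
    refine lt_of_le_of_ne (hf.le_level_of_mem hx) fun e => ?_
    have := hf.apply_branch_level x
    rw [← e, hbx, hw] at this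
    exact hxw this.symm
  have hyx : y ∈ branch T f x (level T f w + 1) := by
    rw [branch, hbx, hw]
    exact mem_side.2 ⟨hy, hxy⟩
  have hly : level T f w + 1 ≤ level T f y := hf.le_level_of_mem hyx
  have hax := hf.isHierarchy.depth x _ hlx
  have hle := hmax (f (branch T f x (level T f w + 1))) ?_ ?_
  · rw [hf.depthIn_eq, hf.depthIn_eq, hax] at hle
    omega
  · rw [eliminationTree, hf.isHierarchy.onPath_iff, hax]
    exact ⟨hlx, rfl⟩
  · rw [eliminationTree, hf.isHierarchy.onPath_iff, hax, branch_eq_of_mem hyx le_rfl]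
    exact ⟨hly, rfl⟩

end Branch

/-- The ideal tree decomposition: every tree on `n ≥ 1` vertices has a tree decomposition
with pivot size at most `2` and depth at most `2⌈log₂ n⌉ + 2`. -/
theorem ideal_tree_decomposition {V : Type*} [Fintype V] (T : SimpleGraph V) (hT : T.IsTree)
    (hn : 1 ≤ Fintype.card V) :
    ∃ (H : SimpleGraph V) (g : V),
      H.IsTree ∧
      (∀ x y w : V, IsLCA H g x y w → OnPath T x y w) ∧
      (∀ z : V, IsComp T (descSet H g z)) ∧
      (∀ z : V, (nbhd T (descSet H g z)).ncard ≤ 2) ∧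
      (∀ x : V, depthIn H g x ≤ 2 * Nat.clog 2 (Fintype.card V) + 2) := by
  obtain ⟨f, hf⟩ := exists_isPivotRule hT
  have : Nonempty V := hT.connected.nonempty
  refine ⟨eliminationTree T f, f Finset.univ, hf.isHierarchy.isTree,
    fun x y w => hf.onPath_of_isLCA, fun z => ?_, fun z => ?_, fun x => ?_⟩
  · rw [hf.descSet_eq]
    have h := (hf.branch_spec_of_le_level (le_refl (level T f z))).1
    exact h.convex.isComp hT h.nonempty
  · rw [hf.descSet_eq]
    exact (hf.branch_spec_of_le_level le_rfl).1.ncard_nbhd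
  · rw [hf.depthIn_eq]
    have h := (hf.branch_spec_of_le_level (le_refl (level T f x))).2.2
    rw [heightBound_univ] at h
    have := Nat.log_le_clog 2 (Fintype.card V)
    omega
end

section
/- For every tree T on n ≥ 1 vertices there exists a tree decomposition H of T of depth at most ⌊log₂ n⌋ + 1 such that for every node z, every vertex of Γ[C(z)] is an ancestor of z in H; in particular, the pivot size of H is at most ⌊log₂ n⌋. -/
open SimpleGraph

/-- `x` and `y` are joined by a walk of `T` all of whose vertices lie in `S`. -/
def WalkJoinedIn {V : Type*} (T : SimpleGraph V) (S : Set V) (x y : V) : Prop :=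
  ∃ p : T.Walk x y, ∀ v ∈ p.support, v ∈ S

namespace WalkJoinedIn

variable {V : Type*} {T : SimpleGraph V} {S S' : Set V} {x y z : V}

theorem refl (hx : x ∈ S) : WalkJoinedIn T S x x :=
  ⟨Walk.nil, by simpa using hx⟩

theorem symm (h : WalkJoinedIn T S x y) : WalkJoinedIn T S y x := by
  obtain ⟨p, hp⟩ := h
  exact ⟨p.reverse, by simpa using hp⟩

theorem trans (h : WalkJoinedIn T S x y) (h' : WalkJoinedIn T S y z) : WalkJoinedIn T S x z := by
  obtain ⟨p, hp⟩ := h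
  obtain ⟨q, hq⟩ := h'
  refine ⟨p.append q, fun v hv => ?_⟩
  rw [Walk.mem_support_append_iff] at hv
  exact hv.elim (hp v) (hq v)

theorem mono (h : WalkJoinedIn T S x y) (hS : S ⊆ S') : WalkJoinedIn T S' x y := by
  obtain ⟨p, hp⟩ := h
  exact ⟨p, fun v hv => hS (hp v hv)⟩

theorem right_mem (h : WalkJoinedIn T S x y) : y ∈ S := by
  obtain ⟨p, hp⟩ := h
  exact hp y p.end_mem_support

theorem left_mem (h : WalkJoinedIn T S x y) : x ∈ S := h.symm.right_mem

theorem of_adj (h : T.Adj x y) (hx : x ∈ S) (hy : y ∈ S) : WalkJoinedIn T S x y :=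
  ⟨h.toWalk, by simp [Adj.toWalk, hx, hy]⟩

theorem of_walk (p : T.Walk x y) (hp : ∀ v ∈ p.support, v ∈ S) {v : V} (hv : v ∈ p.support) :
    WalkJoinedIn T S x v := by
  classical
  exact ⟨p.takeUntil v hv, fun u hu => hp u (p.support_takeUntil_subset_support hv hu)⟩

theorem setOf_eq (h : WalkJoinedIn T S x y) : {v | WalkJoinedIn T S x v} = {v | WalkJoinedIn T S y v} :=
  Set.ext fun _ => ⟨h.symm.trans, h.trans⟩

end WalkJoinedIn

theorem SimpleGraph.IsTree.length_eq_dist {V : Type*} {T : SimpleGraph V} (hT : T.IsTree) {x y : V}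
    {p : T.Walk x y} (hp : p.IsPath) : p.length = T.dist x y := by
  obtain ⟨q, hq, hl⟩ := hT.connected.exists_path_of_dist x y
  have hpq : p = q :=
    congrArg Subtype.val ((hT.isAcyclic.subsingleton_path x y).elim ⟨p, hp⟩ ⟨q, hq⟩)
  rw [← hl, hpq]

theorem SimpleGraph.IsTree.onPath_iff {V : Type*} {T : SimpleGraph V} (hT : T.IsTree) {x y w : V}
    {p : T.Walk x y} (hp : p.IsPath) : OnPath T x y w ↔ w ∈ p.support := by
  refine ⟨fun h => h p hp, fun h q hq => ?_⟩
  have hpq : p = q :=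
    congrArg Subtype.val ((hT.isAcyclic.subsingleton_path x y).elim ⟨p, hp⟩ ⟨q, hq⟩)
  rwa [← hpq]

theorem SimpleGraph.IsTree.dist_eq_succ_of_walkJoinedIn {V : Type*} {T : SimpleGraph V} (hT : T.IsTree)
    {c u v : V} (hcu : T.Adj c u) (h : WalkJoinedIn T {c}ᶜ u v) : T.dist c v = T.dist u v + 1 := by
  classical
  obtain ⟨p, hp⟩ := h
  have hc : c ∉ p.bypass.support := fun hc => hp c (p.support_bypass_subset_support hc) rfl
  have hpath : (Walk.cons hcu p.bypass).IsPath := (p.bypass_isPath).cons hc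
  rw [← hT.length_eq_dist hpath, ← hT.length_eq_dist p.bypass_isPath, Walk.length_cons]

/-- A centroid: every piece of the `S`-component of `x` left by removing `c` has at most half of
its vertices. -/
theorem SimpleGraph.IsTree.exists_centroid {V : Type*} [Fintype V] {T : SimpleGraph V}
    (hT : T.IsTree) {S : Set V} {x : V} (hx : x ∈ S) :
    ∃ c, WalkJoinedIn T S x c ∧ ∀ y, WalkJoinedIn T S x y → y ≠ c →
      2 * {v | WalkJoinedIn T (S \ {c}) y v}.ncard ≤ {v | WalkJoinedIn T S x v}.ncard := by
  classical
  let K : Finset V := Finset.univ.filter (WalkJoinedIn T S x)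
  have hxK : x ∈ K := by simpa [K] using WalkJoinedIn.refl hx
  obtain ⟨c, hcK, hmin⟩ := K.exists_min_image (fun c => ∑ v ∈ K, T.dist c v) ⟨x, hxK⟩
  have hc : WalkJoinedIn T S x c := by simpa [K] using hcK
  refine ⟨c, hc, fun y hy hyc => ?_⟩
  obtain ⟨p, hp⟩ := hc.symm.trans hy
  obtain ⟨u, hcu, huy⟩ : ∃ u, T.Adj c u ∧ WalkJoinedIn T (S \ {c}) u y := by
    have hq := p.bypass_isPath
    have hqS : ∀ v ∈ p.bypass.support, v ∈ S := fun v hv => hp v (p.support_bypass_subset_support hv)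
    generalize p.bypass = q at hq hqS
    cases q with
    | nil => exact absurd rfl hyc
    | cons h q =>
      rw [Walk.cons_isPath_iff] at hq
      exact ⟨_, h, q, fun v hv => ⟨hqS v (by simp [hv]), fun hvc => hq.2 (hvc ▸ hv)⟩⟩
  have huS : WalkJoinedIn T S x u := hy.trans (huy.mono Set.sdiff_subset).symm
  let B : Finset V := K.filter (WalkJoinedIn T (S \ {c}) u)
  have hB : {v | WalkJoinedIn T (S \ {c}) y v}.ncard = B.card := by
    rw [← Set.ncard_coe_finset]
    congr 1
    ext v
    simp only [B, K, Set.mem_ofPred_eq, Finset.coe_filter, Finset.mem_filter, Finset.mem_univ,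
      true_and]
    exact ⟨fun h => ⟨hy.trans (h.mono Set.sdiff_subset), huy.trans h⟩, fun h => huy.symm.trans h.2⟩
  have hK : {v | WalkJoinedIn T S x v}.ncard = K.card := by
    rw [← Set.ncard_coe_finset]
    simp [K]
  rw [hB, hK]
  have hle : ∑ v ∈ K, (T.dist u v + if WalkJoinedIn T (S \ {c}) u v then 2 else 0) ≤
      ∑ v ∈ K, (T.dist c v + 1) := by
    refine Finset.sum_le_sum fun v _ => ?_
    split_ifs with h
    · have := hT.dist_eq_succ_of_walkJoinedIn hcu (h.mono fun a ha => ha.2)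
      omega
    · have h1 := hT.connected.dist_triangle (u := u) (v := c) (w := v)
      have h2 := dist_eq_one_iff_adj.2 hcu.symm
      omega
  have hm := hmin u (by simpa [K] using huS)
  rw [Finset.sum_add_distrib, Finset.sum_add_distrib, ← Finset.sum_filter] at hle
  simp only [Finset.sum_const, smul_eq_mul, mul_one] at hle
  change _ + B.card * 2 ≤ _ at hle
  omega

/-- `d` is a vertex ranking of `T` on `S`: any walk in `S` between two distinct vertices of equal
rank meets a vertex of smaller rank. -/
def IsRankingOn {V : Type*} (T : SimpleGraph V) (S : Set V) (d : V → ℕ) : Prop :=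
  ∀ ⦃x y : V⦄ (p : T.Walk x y), (∀ v ∈ p.support, v ∈ S) → x ≠ y → d x = d y →
    ∃ v ∈ p.support, d v < d x

theorem SimpleGraph.IsTree.exists_isRankingOn {V : Type*} [Fintype V] {T : SimpleGraph V}
    (hT : T.IsTree) (k : ℕ) (S : Set V)
    (hS : ∀ x ∈ S, {v | WalkJoinedIn T S x v}.ncard < 2 ^ k) :
    ∃ d : V → ℕ, (∀ x ∈ S, d x < k) ∧ IsRankingOn T S d := by
  classical
  induction k generalizing S with
  | zero =>
    have hempty : ∀ x, x ∉ S := fun x hx => by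
      have h0 : {v | WalkJoinedIn T S x v}.ncard = 0 := by simpa using hS x hx
      rw [Set.ncard_eq_zero] at h0
      exact (h0 ▸ WalkJoinedIn.refl hx : x ∈ (∅ : Set V))
    exact ⟨0, fun x hx => absurd hx (hempty x),
      fun x y p hp => absurd (hp x p.start_mem_support) (hempty x)⟩
  | succ k ih =>
    have hcent : ∀ K : Set V, ∃ c, ∀ x ∈ S, K = {v | WalkJoinedIn T S x v} →
        ∀ y, WalkJoinedIn T S x y → y ≠ c → 2 * {v | WalkJoinedIn T (S \ {c}) y v}.ncard ≤ K.ncard := by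
      intro K
      by_cases h : ∃ x ∈ S, K = {v | WalkJoinedIn T S x v}
      · obtain ⟨x, hx, rfl⟩ := h
        obtain ⟨c, -, hc⟩ := hT.exists_centroid hx
        refine ⟨c, fun x' hx' he y hy => hc y ?_⟩
        exact (he ▸ hy : y ∈ {v | WalkJoinedIn T S x v})
      · obtain ⟨c⟩ := hT.connected.nonempty
        exact ⟨c, fun x hx he => absurd ⟨x, hx, he⟩ h⟩
    choose c hc using hcent
    let S' : Set V := {x ∈ S | x ≠ c {v | WalkJoinedIn T S x v}}
    obtain ⟨d, hdk, hd⟩ := ih S' fun y hy => by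
      have h1 := hc _ y hy.1 rfl y (WalkJoinedIn.refl hy.1) hy.2
      have h2 := hS y hy.1
      have h3 : {v | WalkJoinedIn T S' y v}.ncard ≤
          {v | WalkJoinedIn T (S \ {c {v | WalkJoinedIn T S y v}}) y v}.ncard := by
        refine Set.ncard_le_ncard (fun v hv => ?_) (Set.toFinite _)
        obtain ⟨p, hp⟩ := hv
        refine ⟨p, fun u hu => ⟨(hp u hu).1, fun hue => (hp u hu).2 ?_⟩⟩
        rw [← (WalkJoinedIn.of_walk p (fun v hv => (hp v hv).1) hu).setOf_eq]
        exact hue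
      rw [pow_succ] at h2
      omega
    refine ⟨fun x => if x ∈ S' then d x + 1 else 0, fun x hx => ?_, fun x y p hp hne he => ?_⟩
    · dsimp only
      split_ifs with h
      · exact Nat.succ_lt_succ (hdk x h)
      · exact Nat.succ_pos k
    · dsimp only at he ⊢
      by_cases hx : x ∈ S'
      · have hy : y ∈ S' := by
          by_contra hy
          simp [hx, hy] at he
        simp only [hx, hy, if_true, Nat.add_right_cancel_iff] at he ⊢
        by_cases hall : ∀ v ∈ p.support, v ∈ S'
        · obtain ⟨v, hv, hlt⟩ := hd p hall hne he
          exact ⟨v, hv, by simpa [hall v hv] using hlt⟩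
        · push Not at hall
          obtain ⟨v, hv, hvS⟩ := hall
          exact ⟨v, hv, by simp [hvS]⟩
      · have hy : y ∉ S' := by
          intro hy
          simp [hx, hy] at he
        have hxS := hp x p.start_mem_support
        have hyS := hp y p.end_mem_support
        have hxc : x = c {v | WalkJoinedIn T S x v} := by
          by_contra h
          exact hx ⟨hxS, h⟩
        have hyc : y = c {v | WalkJoinedIn T S y v} := by
          by_contra h
          exact hy ⟨hyS, h⟩
        rw [← WalkJoinedIn.setOf_eq ⟨p, hp⟩] at hyc
        exact absurd (hxc.trans hyc.symm) hne

/-- The order of the elimination forest of a ranking `d`: `z` is `d`-minimal on a walk from `z`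
to `x`. -/
def RankAbove {V : Type*} (T : SimpleGraph V) (d : V → ℕ) (z x : V) : Prop :=
  WalkJoinedIn T {v | d z ≤ d v} z x

namespace RankAbove

variable {V : Type*} {T : SimpleGraph V} {d : V → ℕ} {w x y z : V}

theorem refl (x : V) : RankAbove T d x x := WalkJoinedIn.refl (le_refl (d x))

theorem le (h : RankAbove T d z x) : d z ≤ d x := h.right_mem

theorem trans (h : RankAbove T d z y) (h' : RankAbove T d y x) : RankAbove T d z x :=
  WalkJoinedIn.trans h (h'.mono fun _ hv => h.le.trans hv)

theorem of_le (hz : RankAbove T d z x) (hw : RankAbove T d w x) (h : d z ≤ d w) :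
    RankAbove T d z w :=
  WalkJoinedIn.trans hz (WalkJoinedIn.mono hw fun _ hv => h.trans hv).symm

theorem eq_of_rank_eq (hd : IsRankingOn T Set.univ d) (h : RankAbove T d z x) (he : d z = d x) :
    z = x := by
  by_contra hne
  obtain ⟨p, hp⟩ := h
  obtain ⟨v, hv, hlt⟩ := hd p (fun _ _ => Set.mem_univ _) hne he
  exact (hp v hv).not_gt hlt

theorem rank_lt (hd : IsRankingOn T Set.univ d) (h : RankAbove T d z x) (hne : z ≠ x) :
    d z < d x :=
  h.le.lt_of_ne fun he => hne (h.eq_of_rank_eq hd he)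

end RankAbove

/-- The graph joining every vertex other than `g` to its parent. -/
def parentGraph {V : Type*} (g : V) (par : V → V) : SimpleGraph V :=
  SimpleGraph.fromRel fun x y => x ≠ g ∧ par x = y

theorem parentGraph_adj_parent {V : Type*} {g x : V} {par : V → V} {d : V → ℕ}
    (hd : ∀ x, x ≠ g → d (par x) < d x) (hx : x ≠ g) : (parentGraph g par).Adj (par x) x := by
  rw [parentGraph, SimpleGraph.fromRel_adj]
  exact ⟨fun h => (hd x hx).ne (congrArg d h), Or.inr ⟨hx, rfl⟩⟩

theorem isTree_parentGraph {V : Type*} [Fintype V] {g : V} {par : V → V} {d : V → ℕ}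
    (hd : ∀ x, x ≠ g → d (par x) < d x) : (parentGraph g par).IsTree := by
  classical
  have hreach : ∀ n x, d x = n → (parentGraph g par).Reachable g x := by
    intro n
    induction n using Nat.strong_induction_on with
    | _ n ih =>
      intro x hx
      by_cases hg : x = g
      · rw [hg]
      · exact (ih _ (hx ▸ hd x hg) (par x) rfl).trans (parentGraph_adj_parent hd hg).reachable
  have hconn : (parentGraph g par).Connected :=
    { preconnected := fun x y => (hreach _ x rfl).symm.trans (hreach _ y rfl)
      nonempty := ⟨g⟩ }
  rw [isTree_iff_connected_and_card]
  refine ⟨hconn, le_antisymm ?_ hconn.card_vert_le_card_edgeSet_add_one⟩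
  have hsub : (parentGraph g par).edgeSet ⊆ (fun x => s(x, par x)) '' {g}ᶜ := by
    intro e
    induction e with
    | _ x y =>
      rw [mem_edgeSet, parentGraph, SimpleGraph.fromRel_adj]
      rintro ⟨-, ⟨hx, rfl⟩ | ⟨hy, rfl⟩⟩
      · exact ⟨x, hx, rfl⟩
      · exact ⟨y, hy, Sym2.eq_swap⟩
  have h1 := Set.ncard_le_ncard hsub (Set.toFinite _)
  have h2 := Set.ncard_image_le (f := fun x => s(x, par x)) (Set.toFinite ({g}ᶜ : Set V))
  have h3 := Set.ncard_add_ncard_compl ({g} : Set V)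
  rw [Set.ncard_singleton] at h3
  rw [Set.ncard_def, Set.encard] at h1
  change Nat.card _ ≤ _ at h1
  omega

/-- A ranking of a tree yields a rooted tree whose ancestor relation is `RankAbove` and whose
depths are bounded by the ranks. -/
theorem IsRankingOn.exists_rootedTree {V : Type*} [Fintype V] {T : SimpleGraph V}
    (hT : T.Connected) {d : V → ℕ} (hd : IsRankingOn T Set.univ d) :
    ∃ (H : SimpleGraph V) (g : V), H.IsTree ∧ (∀ x w, OnPath H g x w ↔ RankAbove T d w x) ∧
      ∀ x, H.dist g x ≤ d x := by
  classical
  have := hT.nonempty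
  obtain ⟨g, -, hg⟩ := Finset.univ.exists_min_image d Finset.univ_nonempty
  have hroot : ∀ x, RankAbove T d g x := fun x => by
    obtain ⟨p⟩ := hT.preconnected g x
    exact ⟨p, fun v _ => hg v (Finset.mem_univ v)⟩
  have hpar : ∀ x, ∃ y, x ≠ g → (RankAbove T d y x ∧ d y < d x) ∧
      ∀ w, RankAbove T d w x → w ≠ x → RankAbove T d w y := by
    intro x
    by_cases hx : x = g
    · exact ⟨x, fun h => absurd hx h⟩
    · obtain ⟨y, hy, hmax⟩ := (Finset.univ.filter fun y => RankAbove T d y x ∧ y ≠ x).exists_max_image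
        d ⟨g, by simpa using ⟨hroot x, Ne.symm hx⟩⟩
      simp only [Finset.mem_filter, Finset.mem_univ, true_and] at hy hmax
      exact ⟨y, fun _ => ⟨⟨hy.1, hy.1.rank_lt hd hy.2⟩,
        fun w hw hne => hw.of_le hy.1 (hmax w ⟨hw, hne⟩)⟩⟩
  choose par hpar using hpar
  have hlt : ∀ x, x ≠ g → d (par x) < d x := fun x hx => (hpar x hx).1.2
  have hH := isTree_parentGraph hlt
  have hpath : ∀ n x, d x = n → ∃ p : (parentGraph g par).Walk g x, p.IsPath ∧
      (∀ w, w ∈ p.support ↔ RankAbove T d w x) ∧ p.length ≤ d x := by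
    intro n
    induction n using Nat.strong_induction_on with
    | _ n ih =>
      intro x hx
      by_cases hxg : x = g
      · subst hxg
        refine ⟨Walk.nil, Walk.IsPath.nil, fun w => ?_, Nat.zero_le _⟩
        rw [Walk.support_nil, List.mem_singleton]
        refine ⟨fun h => h ▸ RankAbove.refl _, fun h => ?_⟩
        exact h.eq_of_rank_eq hd (le_antisymm h.le (hg w (Finset.mem_univ w)))
      · obtain ⟨p, hp, hmem, hlen⟩ := ih _ (hx ▸ hlt x hxg) (par x) rfl
        have hl := hlt x hxg
        refine ⟨p.concat (parentGraph_adj_parent hlt hxg), hp.concat (fun h => ?_) _,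
          fun w => ?_, ?_⟩
        · exact ((hmem x).1 h).le.not_gt hl
        · rw [Walk.support_concat, List.mem_append, hmem, List.mem_singleton]
          refine ⟨?_, fun h => ?_⟩
          · rintro (h | rfl)
            · exact h.trans (hpar x hxg).1.1
            · exact RankAbove.refl _
          · by_cases hw : w = x
            · exact Or.inr hw
            · exact Or.inl ((hpar x hxg).2 w h hw)
        · rw [Walk.length_concat]
          omega
  refine ⟨parentGraph g par, g, hH, fun x w => ?_, fun x => ?_⟩
  · obtain ⟨p, hp, hmem, -⟩ := hpath _ x rfl
    rw [hH.onPath_iff hp, hmem]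
  · obtain ⟨p, -, -, hlen⟩ := hpath _ x rfl
    exact (dist_le p).trans hlen

theorem SimpleGraph.IsTree.dist_lt_of_onPath {V : Type*} {H : SimpleGraph V} (hH : H.IsTree)
    {g w x : V} (h : OnPath H g x w) (hne : w ≠ x) : H.dist g w < H.dist g x := by
  classical
  obtain ⟨p, hp, hl⟩ := hH.connected.exists_path_of_dist g x
  rw [← hl]
  exact (dist_le (p.takeUntil w (h p hp))).trans_lt (p.length_takeUntil_lt_length (h p hp) hne)

/-- Balancing tree decomposition: every tree on `n ≥ 1` vertices has a tree decomposition of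
depth at most `⌊log₂ n⌋ + 1` in which every neighbor of `C(z)` is an ancestor of `z`; in
particular the pivot size is at most `⌊log₂ n⌋`. -/
theorem balancing_tree_decomposition {V : Type*} [Fintype V] (T : SimpleGraph V) (hT : T.IsTree)
    (hn : 1 ≤ Fintype.card V) :
    ∃ (H : SimpleGraph V) (g : V),
      H.IsTree ∧
      (∀ x y w : V, IsLCA H g x y w → OnPath T x y w) ∧
      (∀ z : V, IsComp T (descSet H g z)) ∧
      (∀ x : V, depthIn H g x ≤ Nat.log 2 (Fintype.card V) + 1) ∧
      (∀ z : V, ∀ x ∈ nbhd T (descSet H g z), IsAncestor H g x z) ∧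
      (∀ z : V, (nbhd T (descSet H g z)).ncard ≤ Nat.log 2 (Fintype.card V)) := by
  classical
  obtain ⟨d, hdk, hd⟩ := hT.exists_isRankingOn (Nat.log 2 (Fintype.card V) + 1) Set.univ
    fun x _ => ((Set.ncard_le_card _).trans_eq Nat.card_eq_fintype_card).trans_lt
      (Nat.lt_pow_succ_log_self one_lt_two _)
  have hdle : ∀ x, d x ≤ Nat.log 2 (Fintype.card V) := fun x =>
    Nat.le_of_lt_succ (hdk x (Set.mem_univ x))
  obtain ⟨H, g, hH, hon, hdist⟩ := hd.exists_rootedTree hT.connected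
  have hdesc : ∀ z, descSet H g z = {x | RankAbove T d z x} := fun z => by
    ext x
    simp only [descSet, IsAncestor, hon, Set.mem_ofPred_eq]
    refine ⟨?_, fun h => ?_⟩
    · rintro (rfl | h)
      · exact RankAbove.refl _
      · exact h.2
    · by_cases hx : x = z
      · exact Or.inl hx
      · exact Or.inr ⟨Ne.symm hx, h⟩
  have hnb : ∀ z, ∀ x ∈ nbhd T (descSet H g z), x ≠ z ∧ RankAbove T d x z := by
    intro z x hx
    rw [hdesc] at hx
    obtain ⟨hxz, y, hy, hxy⟩ := hx
    simp only [Set.mem_ofPred_eq] at hxz hy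
    have hlt : d x < d z := by
      by_contra! hle
      exact hxz (WalkJoinedIn.trans hy (WalkJoinedIn.of_adj hxy.symm hy.le hle))
    have hxy' : RankAbove T d x y := WalkJoinedIn.of_adj hxy (le_refl (d x)) (hlt.le.trans hy.le)
    exact ⟨fun h => hlt.ne (congrArg d h), hxy'.of_le hy hlt.le⟩
  refine ⟨H, g, hH, ?_, fun z => ?_, fun x => ?_, fun z x hx => ?_, fun z => ?_⟩
  · intro x y w ⟨hwx, hwy, hmax⟩ p hp
    rw [hon] at hwx hwy
    obtain ⟨m, hm, hmin⟩ := p.support.toFinset.exists_min_image d ⟨x, by simp⟩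
    simp only [List.mem_toFinset] at hm hmin
    have hmx : RankAbove T d m x :=
      (WalkJoinedIn.of_walk p hmin hm).symm
    have hmy : RankAbove T d m y :=
      WalkJoinedIn.trans hmx ⟨p, hmin⟩
    have hwm : d w ≤ d m := by
      obtain ⟨q, hq⟩ := WalkJoinedIn.trans (WalkJoinedIn.symm hwx) hwy
      have := (hT.onPath_iff hp).2 hm _ q.bypass_isPath
      exact hq m (q.support_bypass_subset_support this)
    have hle := hmax m ((hon _ _).2 hmx) ((hon _ _).2 hmy)
    by_cases hne : w = m
    · rwa [hne]
    · have := hH.dist_lt_of_onPath ((hon _ _).2 (hwx.of_le hmx hwm)) hne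
      simp only [depthIn] at hle
      omega
  · rw [hdesc, IsComp]
    refine connected_iff_exists_forall_reachable _ |>.2 ⟨⟨z, RankAbove.refl z⟩, fun ⟨x, hx⟩ => ?_⟩
    obtain ⟨p, hp⟩ := id hx
    exact ⟨p.induce _ fun v hv => WalkJoinedIn.of_walk p hp hv⟩
  · exact Nat.succ_le_succ ((hdist x).trans (hdle x))
  · exact ⟨(hnb z x hx).1, (hon _ _).2 (hnb z x hx).2⟩
  · refine le_trans ?_ (hdle z)
    rw [← Finset.card_range (d z), ← Set.ncard_coe_finset]
    refine Set.ncard_le_ncard_of_injOn d (fun x hx => ?_) (fun x hx y hy he => ?_)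
      (Finset.finite_toSet _)
    · simpa using (hnb z x hx).2.rank_lt hd (hnb z x hx).1
    · exact ((hnb z x hx).2.of_le (hnb z y hy).2 he.le).eq_of_rank_eq hd he
end

section
/- Let T be a tree on vertex set V and let H be a tree decomposition of T with pivot size θ. For a path d in T, let μ(d) denote the unique vertex of d of minimum H-depth. Then there exists a function π assigning to each path d of T a set π(d) of at most 2(θ+1) edges of d such that: for any two overlapping paths d₁, d₂ of T, if the H-depth of μ(d₁) is at least the H-depth of μ(d₂), then d₂ contains some edge of π(d₁). -/
open SimpleGraph

/-- `m` is a vertex of minimum `H`-depth on the walk `p`. -/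
noncomputable def IsMinDepthVertex {V : Type*} {T : SimpleGraph V} (H : SimpleGraph V) (g : V)
    {a b : V} (p : T.Walk a b) (m : V) : Prop :=
  m ∈ p.support ∧ ∀ w ∈ p.support, depthIn H g m ≤ depthIn H g w

theorem depthIn_lt_of_onPath {V : Type*} {H : SimpleGraph V} (hH : H.Connected) {g x w : V}
    (h : OnPath H g x w) (hne : w ≠ x) : depthIn H g w < depthIn H g x := by
  classical
  obtain ⟨p, hp, hlen⟩ := hH.exists_path_of_dist g x
  have hw := h p hp
  have h₁ := congrArg Walk.length (p.take_spec hw)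
  rw [Walk.length_append] at h₁
  have h₂ := dist_le (p.takeUntil w hw)
  have h₃ := dist_le (p.dropUntil w hw)
  have h₄ := hH.pos_dist_of_ne hne
  unfold depthIn
  omega

theorem exists_isLCA {V : Type*} [Finite V] (H : SimpleGraph V) (g x y : V) :
    ∃ w, IsLCA H g x y w := by
  have hne : {w | OnPath H g x w ∧ OnPath H g y w}.Nonempty :=
    ⟨g, fun p _ => p.start_mem_support, fun p _ => p.start_mem_support⟩
  obtain ⟨w, hw, hmax⟩ := Set.exists_max_image _ (depthIn H g) (Set.toFinite _) hne
  exact ⟨w, hw.1, hw.2, fun w' h₁ h₂ => hmax w' ⟨h₁, h₂⟩⟩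

theorem exists_isMinDepthVertex {V : Type*} {T : SimpleGraph V} (H : SimpleGraph V) (g : V)
    {a b : V} (p : T.Walk a b) : ∃ m, IsMinDepthVertex H g p m := by
  obtain ⟨m, hm, hmin⟩ := Set.exists_min_image {w | w ∈ p.support} (depthIn H g)
    (List.finite_toSet _) ⟨a, p.start_mem_support⟩
  exact ⟨m, hm, hmin⟩

/-- Between two vertices of a path there is a path using only edges and vertices of it. -/
theorem exists_isPath_between {V : Type*} {T : SimpleGraph V} {a b s x : V} {q : T.Walk a b}
    (hq : q.IsPath) (hs : s ∈ q.support) (hx : x ∈ q.support) :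
    ∃ w : T.Walk s x, w.IsPath ∧ w.support ⊆ q.support ∧ w.edges ⊆ q.edges := by
  classical
  by_cases h : x ∈ (q.dropUntil s hs).support
  · exact ⟨(q.dropUntil s hs).takeUntil x h, (hq.dropUntil hs).takeUntil h,
      fun y hy => q.support_dropUntil_subset_support hs
        ((q.dropUntil s hs).support_takeUntil_subset_support h hy),
      fun e he => q.edges_dropUntil_subset_edges hs
        ((q.dropUntil s hs).edges_takeUntil_subset_edges h he)⟩
  · have h' : x ∈ (q.takeUntil s hs).support := by
      rw [← q.take_spec hs, Walk.mem_support_append_iff] at hx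
      exact hx.resolve_right h
    refine ⟨((q.takeUntil s hs).dropUntil x h').reverse,
      ((hq.takeUntil hs).dropUntil h').reverse, ?_, ?_⟩
    · intro y hy
      rw [Walk.support_reverse, List.mem_reverse] at hy
      exact q.support_takeUntil_subset_support hs
        ((q.takeUntil s hs).support_dropUntil_subset_support h' hy)
    · intro e he
      rw [Walk.edges_reverse, List.mem_reverse] at he
      exact q.edges_takeUntil_subset_edges hs ((q.takeUntil s hs).edges_dropUntil_subset_edges h' he)

theorem edges_subset_of_isAcyclic {V : Type*} {T : SimpleGraph V} (hT : T.IsAcyclic)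
    {a b s x : V} {q : T.Walk a b} (hq : q.IsPath) (hs : s ∈ q.support) (hx : x ∈ q.support)
    {w : T.Walk s x} (hw : w.IsPath) : w.edges ⊆ q.edges := by
  obtain ⟨w', hw', -, he⟩ := exists_isPath_between hq hs hx
  have : w = w' := by
    have := hT.subsingleton_path s x
    exact congrArg Subtype.val (Subsingleton.elim (⟨w, hw⟩ : T.Path s x) ⟨w', hw'⟩)
  exact this ▸ he

theorem isPath_append_of_support_inter {V : Type*} {T : SimpleGraph V} {s b x : V}
    {r : T.Walk s b} {w : T.Walk b x} (hr : r.IsPath) (hw : w.IsPath)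
    (h : ∀ y ∈ r.support, y ∈ w.support → y = b) : (r.append w).IsPath := by
  rw [Walk.isPath_def, Walk.support_append, List.nodup_append]
  have hnd := hw.support_nodup
  rw [← Walk.cons_tail_support, List.nodup_cons] at hnd
  refine ⟨hr.support_nodup, hnd.2, ?_⟩
  rintro y hy z hz rfl
  have := h y hy (List.mem_of_mem_tail hz)
  exact hnd.1 (this ▸ hz)

/-- If a path `p` leaves the path `r` from `s` at `b`, then every path through `s` and through a
vertex of `p` other than `b` uses the first edge of `p`. -/
theorem exists_first_edge_of_isAcyclic {V : Type*} {T : SimpleGraph V} (hT : T.IsAcyclic)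
    {s b v : V} {r : T.Walk s b} {p : T.Walk b v} (hr : r.IsPath) (hp : p.IsPath)
    (h : ∀ y ∈ r.support, y ∈ p.support → y = b) :
    ∃ W : Set (Sym2 V), (∀ e ∈ W, e ∈ p.edges) ∧ W.ncard ≤ 1 ∧
      ∀ (c d : V) (q : T.Walk c d), q.IsPath → s ∈ q.support →
        (∃ x ∈ p.support, x ≠ b ∧ x ∈ q.support) → ∃ e ∈ W, e ∈ q.edges := by
  classical
  cases p with
  | nil =>
    refine ⟨∅, by simp, by simp, ?_⟩
    rintro c d q - - ⟨x, hx, hxb, -⟩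
    simp [hxb] at hx
  | @cons _ b' _ hadj p' =>
    refine ⟨{s(b, b')}, by simp, by simp, ?_⟩
    rintro c d q hq hs ⟨x, hx, hxb, hxq⟩
    refine ⟨_, rfl, ?_⟩
    have hx' : x ∈ p'.support := by simpa [hxb] using hx
    have hpath : (Walk.cons hadj (p'.takeUntil x hx')).IsPath := by
      rw [Walk.cons_isPath_iff] at hp ⊢
      exact ⟨hp.1.takeUntil hx', fun hb => hp.2 (p'.support_takeUntil_subset_support hx' hb)⟩
    refine edges_subset_of_isAcyclic hT hq hs hxq
      (isPath_append_of_support_inter hr hpath fun y hy hyw => h y hy ?_) ?_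
    · rw [Walk.support_cons, List.mem_cons] at hyw ⊢
      exact hyw.imp_right fun hb => p'.support_takeUntil_subset_support hx' hb
    · simp [Walk.edges_append]

/-- In a tree, the at most two edges of a path `p` at the vertex of `p` closest to `s` meet every
path through `s` that overlaps `p`. -/
theorem exists_wings {V : Type*} {T : SimpleGraph V} (hT : T.IsTree) {u v : V} {p : T.Walk u v}
    (hp : p.IsPath) (s : V) :
    ∃ W : Set (Sym2 V), (∀ e ∈ W, e ∈ p.edges) ∧ W.ncard ≤ 2 ∧
      ∀ (c d : V) (q : T.Walk c d), q.IsPath → s ∈ q.support →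
        (∃ e, e ∈ p.edges ∧ e ∈ q.edges) → ∃ e ∈ W, e ∈ q.edges := by
  classical
  obtain ⟨b, hb : b ∈ p.support, hmin⟩ := Set.exists_min_image {w | w ∈ p.support} (T.dist s)
    (List.finite_toSet _) ⟨u, p.start_mem_support⟩
  obtain ⟨r, hr, hlen⟩ := hT.connected.exists_path_of_dist s b
  have hinter : ∀ y ∈ r.support, y ∈ p.support → y = b := by
    intro y hy hyp
    by_contra hne
    have h₁ := congrArg Walk.length (r.take_spec hy)
    rw [Walk.length_append] at h₁
    have h₂ := dist_le (r.takeUntil y hy)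
    have h₃ := dist_le (r.dropUntil y hy)
    have h₄ := hT.connected.pos_dist_of_ne hne
    have h₅ := hmin y hyp
    omega
  obtain ⟨W₁, hsub₁, hcard₁, hW₁⟩ := exists_first_edge_of_isAcyclic hT.isAcyclic hr
    (hp.dropUntil hb)
    fun y hy hyp => hinter y hy (p.support_dropUntil_subset_support hb hyp)
  obtain ⟨W₂, hsub₂, hcard₂, hW₂⟩ := exists_first_edge_of_isAcyclic hT.isAcyclic hr
    (hp.takeUntil hb).reverse
    fun y hy hyp => hinter y hy (p.support_takeUntil_subset_support hb (by simpa using hyp))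
  refine ⟨W₁ ∪ W₂, ?_, (Set.ncard_union_le _ _).trans (by omega), ?_⟩
  · rintro e (he | he)
    · exact p.edges_dropUntil_subset_edges hb (hsub₁ e he)
    · exact p.edges_takeUntil_subset_edges hb (by simpa using hsub₂ e he)
  · rintro c d q hq hs ⟨e, hep, heq⟩
    obtain ⟨x, hxp, hxb, hxq⟩ : ∃ x ∈ p.support, x ≠ b ∧ x ∈ q.support := by
      induction e with | _ x y
      by_cases hxb : x = b
      · exact ⟨y, p.snd_mem_support_of_mem_edges hep,
          fun hy => (p.adj_of_mem_edges hep).ne (hxb.trans hy.symm),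
          q.snd_mem_support_of_mem_edges heq⟩
      · exact ⟨x, p.fst_mem_support_of_mem_edges hep, hxb, q.fst_mem_support_of_mem_edges heq⟩
    rw [← p.take_spec hb, Walk.mem_support_append_iff] at hxp
    rcases hxp with hx | hx
    · obtain ⟨f, hf, hfq⟩ := hW₂ c d q hq hs ⟨x, by simpa using hx, hxb, hxq⟩
      exact ⟨f, Or.inr hf, hfq⟩
    · obtain ⟨f, hf, hfq⟩ := hW₁ c d q hq hs ⟨x, hx, hxb, hxq⟩
      exact ⟨f, Or.inl hf, hfq⟩

theorem mem_descSet_of_isMinDepthVertex {V : Type*} [Finite V] {T H : SimpleGraph V} {g : V}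
    (hH : H.Connected) (hlca : ∀ x y w : V, IsLCA H g x y w → OnPath T x y w)
    {u v m : V} {p : T.Walk u v} (hp : p.IsPath) (hm : IsMinDepthVertex H g p m)
    {x : V} (hx : x ∈ p.support) : x ∈ descSet H g m := by
  obtain ⟨w, hw⟩ := exists_isLCA H g m x
  obtain ⟨r, hr, hsub, -⟩ := exists_isPath_between hp hm.1 hx
  have hle := hm.2 w (hsub (hlca m x w hw r hr))
  have hwm : w = m := by
    by_contra hne
    exact absurd (depthIn_lt_of_onPath hH hw.1 hne) (not_lt.mpr hle)
  subst hwm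
  by_cases hxw : x = w
  · exact Or.inl hxw
  · exact Or.inr ⟨Ne.symm hxw, hw.2.1⟩

theorem exists_mem_nbhd_of_walk {V : Type*} {T : SimpleGraph V} {C : Set V} {a b : V}
    (q : T.Walk a b) (ha : a ∈ C) (hb : b ∉ C) : ∃ x ∈ q.support, x ∈ nbhd T C := by
  obtain ⟨d, hd, h₁, h₂⟩ := q.exists_boundary_dart C ha hb
  exact ⟨d.snd, q.dart_snd_mem_support_of_mem_darts hd, h₂, d.fst, h₁, d.adj.symm⟩

theorem exists_critical_edges {V : Type*} [Finite V] {T H : SimpleGraph V} {g : V} {θ : ℕ}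
    (hT : T.IsTree) (hH : H.Connected)
    (hlca : ∀ x y w : V, IsLCA H g x y w → OnPath T x y w)
    (hpivot : ∀ z : V, (nbhd T (descSet H g z)).ncard ≤ θ)
    {u v : V} {p : T.Walk u v} (hp : p.IsPath) :
    ∃ S : Set (Sym2 V), (∀ e ∈ S, e ∈ p.edges) ∧ S.ncard ≤ 2 * (θ + 1) ∧
      ∀ (c d : V) (q : T.Walk c d), q.IsPath → (∃ e, e ∈ p.edges ∧ e ∈ q.edges) →
        ∀ m₁ m₂ : V, IsMinDepthVertex H g p m₁ → IsMinDepthVertex H g q m₂ →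
          depthIn H g m₂ ≤ depthIn H g m₁ → ∃ e ∈ S, e ∈ q.edges := by
  obtain ⟨m, hm⟩ := exists_isMinDepthVertex H g p
  choose W hsub hcard hW using fun s => exists_wings hT hp s
  set U : Set V := insert m (nbhd T (descSet H g m))
  refine ⟨⋃ s ∈ U, W s, ?_, ?_, ?_⟩
  · intro e he
    simp only [Set.mem_iUnion] at he
    obtain ⟨s, -, hs⟩ := he
    exact hsub s e hs
  · have hUcard : U.ncard ≤ θ + 1 :=
      (Set.ncard_insert_le _ _).trans (Nat.add_le_add_right (hpivot m) 1)
    have hfin : U.Finite := Set.toFinite U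
    have hunion : (⋃ s ∈ U, W s) = ⋃ s ∈ hfin.toFinset, W s := by
      simp only [Set.Finite.mem_toFinset]
    rw [Set.ncard_eq_toFinset_card U hfin] at hUcard
    calc (⋃ s ∈ U, W s).ncard ≤ ∑ s ∈ hfin.toFinset, (W s).ncard := by
          rw [hunion]; exact Finset.set_ncard_biUnion_le _ _
      _ ≤ hfin.toFinset.card * 2 := Finset.sum_le_card_nsmul _ _ _ fun s _ => hcard s
      _ ≤ 2 * (θ + 1) := by omega
  · intro c d q hq hover m₁ m₂ hm₁ hm₂ hle
    obtain ⟨s, hsU, hsq⟩ : ∃ s ∈ U, s ∈ q.support := by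
      by_cases hm₂C : m₂ ∈ descSet H g m
      · rcases hm₂C with rfl | hanc
        · exact ⟨m₂, Or.inl rfl, hm₂.1⟩
        · have h₁ := depthIn_lt_of_onPath hH hanc.2 hanc.1
          have h₂ := hm₁.2 m hm.1
          omega
      · obtain ⟨e, hep, heq⟩ := hover
        induction e with | _ x y
        have hxC := mem_descSet_of_isMinDepthVertex hH hlca hp hm
          (p.fst_mem_support_of_mem_edges hep)
        obtain ⟨r, -, hr, -⟩ :=
          exists_isPath_between hq (q.fst_mem_support_of_mem_edges heq) hm₂.1
        obtain ⟨z, hzr, hz⟩ := exists_mem_nbhd_of_walk r hxC hm₂C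
        exact ⟨z, Or.inr hz, hr hzr⟩
    obtain ⟨e, he, heq⟩ := hW s c d q hq hsq hover
    exact ⟨e, Set.mem_biUnion hsU he, heq⟩

/-- Transforming a tree decomposition with pivot size `θ` into a layered decomposition:
there is an assignment `π` of at most `2(θ+1)` critical edges to every path of `T` such that
whenever two paths overlap and the first is captured at depth no smaller than the second, the
second path contains a critical edge of the first. -/
theorem layered_from_tree_decomp {V : Type*} [Fintype V] (T : SimpleGraph V) (hT : T.IsTree)
    (H : SimpleGraph V) (g : V) (θ : ℕ)
    (hHtree : H.IsTree)
    (hlca : ∀ x y w : V, IsLCA H g x y w → OnPath T x y w)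
    (hcomp : ∀ z : V, IsComp T (descSet H g z))
    (hpivot : ∀ z : V, (nbhd T (descSet H g z)).ncard ≤ θ) :
    ∃ π : ∀ u v : V, T.Walk u v → Set (Sym2 V),
      (∀ (u v : V) (p : T.Walk u v), p.IsPath → u ≠ v →
        (∀ e ∈ π u v p, e ∈ p.edges) ∧ (π u v p).ncard ≤ 2 * (θ + 1)) ∧
      (∀ (u₁ v₁ u₂ v₂ : V) (p₁ : T.Walk u₁ v₁) (p₂ : T.Walk u₂ v₂),
        p₁.IsPath → u₁ ≠ v₁ → p₂.IsPath → u₂ ≠ v₂ →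
        (∃ e, e ∈ p₁.edges ∧ e ∈ p₂.edges) →
        ∀ m₁ m₂ : V, IsMinDepthVertex H g p₁ m₁ → IsMinDepthVertex H g p₂ m₂ →
          depthIn H g m₂ ≤ depthIn H g m₁ →
          ∃ e ∈ π u₁ v₁ p₁, e ∈ p₂.edges) := by
  classical
  have key := fun (u v : V) (p : T.Walk u v) (hp : p.IsPath) =>
    exists_critical_edges hT hHtree.connected hlca hpivot hp
  choose S hsub hcard hS using key
  refine ⟨fun u v p => if hp : p.IsPath then S u v p hp else ∅, ?_, ?_⟩
  · intro u v p hp _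
    simp only [dif_pos hp]
    exact ⟨hsub u v p hp, hcard u v p hp⟩
  · intro u₁ v₁ u₂ v₂ p₁ p₂ hp₁ _ hp₂ _ hover m₁ m₂ hm₁ hm₂ hle
    simp only [dif_pos hp₁]
    exact hS u₁ v₁ p₁ hp₁ u₂ v₂ p₂ hp₂ hover m₁ m₂ hm₁ hm₂ hle
end

section
/- For every tree T on n ≥ 2 vertices there exist an integer ℓ with ℓ ≤ 2⌈log₂ n⌉ + 2, a function g assigning to each path of T a group index in {1, …, ℓ}, and a function π assigning to each path d of T a set π(d) of at most 6 edges of d, such that for any two overlapping paths d₁, d₂ of T with g(d₁) ≤ g(d₂), the path d₂ contains some edge of π(d₁). -/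
open SimpleGraph

namespace SimpleGraph

variable {V : Type*} {T : SimpleGraph V}

section Basic

lemma Walk.exists_subwalk {u v x y : V} (q : T.Walk u v) (hx : x ∈ q.support)
    (hy : y ∈ q.support) :
    ∃ r : T.Walk x y, r.support ⊆ q.support ∧ r.edges ⊆ q.edges := by
  classical
  refine ⟨(q.takeUntil x hx).reverse.append (q.takeUntil y hy), fun z hz => ?_, fun e he => ?_⟩
  · rw [Walk.mem_support_append_iff, Walk.support_reverse, List.mem_reverse] at hz
    exact hz.elim (fun h => q.support_takeUntil_subset_support hx h)
      (fun h => q.support_takeUntil_subset_support hy h)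
  · rw [Walk.edges_append, List.mem_append, Walk.edges_reverse, List.mem_reverse] at he
    exact he.elim (fun h => q.edges_takeUntil_subset_edges hx h)
      (fun h => q.edges_takeUntil_subset_edges hy h)

lemma IsTree.path_eq (hT : T.IsTree) {u v : V} {p q : T.Walk u v} (hp : p.IsPath)
    (hq : q.IsPath) : p = q :=
  (hT.existsUnique_path u v).unique hp hq

lemma IsTree.support_subset_of_isPath (hT : T.IsTree) {u v : V} {p : T.Walk u v}
    (hp : p.IsPath) (q : T.Walk u v) : p.support ⊆ q.support := by
  classical
  rw [hT.path_eq hp q.bypass_isPath]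
  exact q.support_bypass_subset_support

lemma IsTree.edges_subset_of_isPath (hT : T.IsTree) {u v : V} {p : T.Walk u v}
    (hp : p.IsPath) (q : T.Walk u v) : p.edges ⊆ q.edges := by
  classical
  rw [hT.path_eq hp q.bypass_isPath]
  exact q.edges_bypass_subset_edges

/-- `T.JoinedOff B u v`: some walk from `u` to `v` avoids every vertex of `B`. -/
def JoinedOff (T : SimpleGraph V) (B : Set V) (u v : V) : Prop :=
  ∃ q : T.Walk u v, ∀ x ∈ q.support, x ∉ B

lemma JoinedOff.refl {B : Set V} {u : V} (hu : u ∉ B) : T.JoinedOff B u u :=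
  ⟨Walk.nil, by simpa using hu⟩

lemma JoinedOff.symm {B : Set V} {u v : V} (h : T.JoinedOff B u v) : T.JoinedOff B v u := by
  obtain ⟨q, hq⟩ := h
  exact ⟨q.reverse, by simpa using hq⟩

lemma JoinedOff.trans {B : Set V} {u v w : V} (h : T.JoinedOff B u v)
    (h' : T.JoinedOff B v w) : T.JoinedOff B u w := by
  obtain ⟨q, hq⟩ := h
  obtain ⟨r, hr⟩ := h'
  refine ⟨q.append r, fun x hx => ?_⟩
  rw [Walk.mem_support_append_iff] at hx
  exact hx.elim (hq x) (hr x)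

lemma JoinedOff.right_notMem {B : Set V} {u v : V} (h : T.JoinedOff B u v) : v ∉ B := by
  obtain ⟨q, hq⟩ := h
  exact hq v q.end_mem_support

lemma JoinedOff.anti {B B' : Set V} (hB : B ⊆ B') {u v : V} (h : T.JoinedOff B' u v) :
    T.JoinedOff B u v := by
  obtain ⟨q, hq⟩ := h
  exact ⟨q, fun x hx hxB => hq x hx (hB hxB)⟩

lemma joinedOff_of_mem_support {B : Set V} {u v x y : V} {q : T.Walk u v}
    (hq : ∀ z ∈ q.support, z ∉ B) (hx : x ∈ q.support) (hy : y ∈ q.support) :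
    T.JoinedOff B x y := by
  obtain ⟨r, hr, -⟩ := q.exists_subwalk hx hy
  exact ⟨r, fun z hz => hq z (hr hz)⟩

/-- The connected component of `s` after deleting the vertices of `B`. -/
def compOff (T : SimpleGraph V) (B : Set V) (s : V) : Set V := {w | T.JoinedOff B s w}

lemma compOff_anti {B B' : Set V} (hB : B ⊆ B') (s : V) : T.compOff B' s ⊆ T.compOff B s :=
  fun _ h => JoinedOff.anti hB h

lemma compOff_eq_of_joinedOff {B : Set V} {s t : V} (h : T.JoinedOff B s t) :
    T.compOff B s = T.compOff B t :=
  Set.ext fun _ => ⟨fun hw => h.symm.trans hw, fun hw => h.trans hw⟩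

lemma compOff_insert_eq {B : Set V} {u b : V} (h : ¬ T.JoinedOff B u b) :
    T.compOff (insert b B) u = T.compOff B u := by
  refine (compOff_anti (Set.subset_insert b B) u).antisymm ?_
  rintro w ⟨q, hq⟩
  refine ⟨q, fun x hx hxB => ?_⟩
  rcases hxB with rfl | hxB
  · exact h (joinedOff_of_mem_support hq q.start_mem_support hx)
  · exact hq x hx hxB

end Basic

section Median

lemma IsTree.not_joinedOff_of_isPath (hT : T.IsTree) {u v m : V} {p : T.Walk u v}
    (hp : p.IsPath) (hm : m ∈ p.support) : ¬ T.JoinedOff {m} u v :=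
  fun ⟨q, hq⟩ => hq m (hT.support_subset_of_isPath hp q hm) rfl

lemma IsTree.not_joinedOff_of_minimal (hT : T.IsTree) {c m a : V} {s : T.Walk c m}
    (hs : s.IsPath) {r : T.Walk m a} (hr : r.IsPath)
    (hd : ∀ z ∈ s.support, z ∈ r.support → z = m) : ¬ T.JoinedOff {m} c a := by
  have hpath : (s.append r).IsPath := by
    rw [Walk.isPath_def, Walk.support_append, List.nodup_append']
    refine ⟨hs.support_nodup, hr.support_nodup.tail, fun z hz hz' => ?_⟩
    obtain rfl := hd z hz (List.mem_of_mem_tail hz')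
    have := hr.support_nodup
    rw [← Walk.cons_tail_support, List.nodup_cons] at this
    exact this.1 hz'
  exact hT.not_joinedOff_of_isPath hpath (by simp [Walk.mem_support_append_iff])

/-- Any three vertices of a tree have a median. -/
lemma IsTree.exists_median (hT : T.IsTree) (a b c : V) :
    ∃ m, ¬ T.JoinedOff {m} a b ∧ ¬ T.JoinedOff {m} c a ∧ ¬ T.JoinedOff {m} c b := by
  classical
  obtain ⟨p, hp, -⟩ := hT.existsUnique_path a b
  obtain ⟨m, hm, hmin⟩ := p.support.toFinset.exists_min_image (T.dist c)
    ⟨a, by simp⟩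
  rw [List.mem_toFinset] at hm
  obtain ⟨s, hs, hsd⟩ := hT.1.exists_path_of_dist c m
  have key : ∀ z ∈ s.support, z ∈ p.support → z = m := by
    intro z hz hzp
    by_contra hne
    have h1 := Walk.length_takeUntil_lt_length hz hne
    have h2 := dist_le (s.takeUntil z hz)
    have h3 := hmin z (by simpa using hzp)
    omega
  refine ⟨m, hT.not_joinedOff_of_isPath hp hm, ?_, ?_⟩
  · refine hT.not_joinedOff_of_minimal hs (hp.takeUntil hm).reverse fun z hz hz' => key z hz ?_
    rw [Walk.support_reverse, List.mem_reverse] at hz'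
    exact p.support_takeUntil_subset_support hm hz'
  · exact hT.not_joinedOff_of_minimal hs (hp.dropUntil hm) fun z hz hz' =>
      key z hz (p.support_dropUntil_subset_support hm hz')

/-- Every path of a tree has a gate towards a given vertex. -/
lemma IsTree.exists_gate (hT : T.IsTree) {u v : V} {p : T.Walk u v} (hp : p.IsPath) (x : V) :
    ∃ m ∈ p.support, ∀ z ∈ p.support, ¬ T.JoinedOff {m} x z := by
  classical
  obtain ⟨m, huv, hu, hv⟩ := hT.exists_median u v x
  have hm : m ∈ p.support := by
    by_contra h
    exact huv ⟨p, fun z hz hzm => h (hzm ▸ hz)⟩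
  refine ⟨m, hm, fun z hz hxz => ?_⟩
  have hzm : z ≠ m := hxz.right_notMem
  have h1 : m ∈ (p.takeUntil z hz).support := by
    by_contra h
    exact hu (hxz.trans (JoinedOff.symm ⟨p.takeUntil z hz, fun w hw hwm => h (hwm ▸ hw)⟩))
  have h2 : m ∈ (p.dropUntil z hz).support := by
    by_contra h
    exact hv (hxz.trans ⟨p.dropUntil z hz, fun w hw hwm => h (hwm ▸ hw)⟩)
  have hnd := hp.support_nodup
  rw [← p.take_spec hz, Walk.support_append, List.nodup_append'] at hnd
  rw [← Walk.cons_tail_support (p.dropUntil z hz), List.mem_cons] at h2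
  exact hnd.2.2 h1 (h2.resolve_left hzm.symm)

end Median

section CriticalEdges

lemma IsTree.exists_first_edge (hT : T.IsTree) {y v : V} {r : T.Walk y v} (hr : r.IsPath) :
    ∃ E : Set (Sym2 V), E ⊆ {e | e ∈ r.edges} ∧ E.ncard ≤ 1 ∧
      ∀ (a b : V) (q : T.Walk a b) (z : V), z ∈ r.support → z ≠ y → y ∈ q.support →
        z ∈ q.support → ∃ e ∈ E, e ∈ q.edges := by
  classical
  cases r with
  | nil => exact ⟨∅, by simp, by simp, fun a b q z hz hzy => absurd (by simpa using hz) hzy⟩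
  | @cons _ w _ h r' =>
    refine ⟨{s(y, w)}, by simp, by simp, fun a b q z hz hzy hyq hzq => ⟨_, rfl, ?_⟩⟩
    obtain ⟨t, -, ht⟩ := q.exists_subwalk hyq hzq
    refine ht (hT.edges_subset_of_isPath (hr.takeUntil hz) t ?_)
    have hz' : z ∈ r'.support := by simpa [hzy] using hz
    rw [Walk.takeUntil_cons hz' hzy.symm]
    simp

lemma IsTree.exists_critical_edges (hT : T.IsTree) {u v : V} {p : T.Walk u v} (hp : p.IsPath)
    (x : V) :
    ∃ E : Set (Sym2 V), E ⊆ {e | e ∈ p.edges} ∧ E.ncard ≤ 2 ∧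
      ∀ (a b : V) (q : T.Walk a b), x ∈ q.support → (∃ e, e ∈ p.edges ∧ e ∈ q.edges) →
        ∃ e ∈ E, e ∈ q.edges := by
  classical
  obtain ⟨m, hm, hgate⟩ := hT.exists_gate hp x
  obtain ⟨E₁, hE₁, hc₁, h₁⟩ := hT.exists_first_edge (hp.takeUntil hm).reverse
  obtain ⟨E₂, hE₂, hc₂, h₂⟩ := hT.exists_first_edge (hp.dropUntil hm)
  refine ⟨E₁ ∪ E₂, ?_, (Set.ncard_union_le _ _).trans (by omega), ?_⟩
  · rintro e (he | he)
    · have := hE₁ he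
      simp only [Set.mem_ofPred_eq, Walk.edges_reverse, List.mem_reverse] at this
      exact p.edges_takeUntil_subset_edges hm this
    · exact p.edges_dropUntil_subset_edges hm (hE₂ he)
  · rintro a b q hxq ⟨e, hep, heq⟩
    obtain ⟨z, hze, hzm⟩ : ∃ z ∈ e, z ≠ m := by
      induction e with
      | _ α β =>
        have := (p.adj_of_mem_edges hep).ne
        by_cases h : α = m
        · exact ⟨β, by simp, fun h' => this (h.trans h'.symm)⟩
        · exact ⟨α, by simp, h⟩
    have hzp := Walk.mem_support_of_mem_edges hep hze
    have hzq := Walk.mem_support_of_mem_edges heq hze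
    have hmq : m ∈ q.support := by
      by_contra h
      exact hgate z hzp
        (joinedOff_of_mem_support (fun w hw hwm => h (hwm ▸ hw)) hxq hzq)
    rw [← p.take_spec hm, Walk.mem_support_append_iff] at hzp
    rcases hzp with hz | hz
    · obtain ⟨e, he, he'⟩ := h₁ a b q z (by simpa using hz) hzm hmq hzq
      exact ⟨e, Or.inl he, he'⟩
    · obtain ⟨e, he, he'⟩ := h₂ a b q z hz hzm hmq hzq
      exact ⟨e, Or.inr he, he'⟩

lemma IsTree.exists_critical_edges_finset (hT : T.IsTree) {u v : V} {p : T.Walk u v}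
    (hp : p.IsPath) (X : Finset V) :
    ∃ E : Set (Sym2 V), E ⊆ {e | e ∈ p.edges} ∧ E.ncard ≤ 2 * X.card ∧
      ∀ (a b : V) (q : T.Walk a b), (∃ x ∈ X, x ∈ q.support) →
        (∃ e, e ∈ p.edges ∧ e ∈ q.edges) → ∃ e ∈ E, e ∈ q.edges := by
  choose E hE hc h using fun x => hT.exists_critical_edges hp x
  refine ⟨⋃ x ∈ X, E x, Set.iUnion₂_subset fun x _ => hE x, ?_, ?_⟩
  · calc (⋃ x ∈ X, E x).ncard ≤ ∑ x ∈ X, (E x).ncard := X.set_ncard_biUnion_le E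
      _ ≤ ∑ _x ∈ X, 2 := Finset.sum_le_sum fun x _ => hc x
      _ = 2 * X.card := by simp [mul_comm]
  · rintro a b q ⟨x, hx, hxq⟩ ho
    obtain ⟨e, he, he'⟩ := h x a b q hxq ho
    exact ⟨e, Set.mem_biUnion hx he, he'⟩

end CriticalEdges

section Centroid

/-- Every component obtained by deleting vertices from a finite tree has a centroid. -/
lemma IsTree.exists_centroid_s5 [Finite V] (hT : T.IsTree) (B : Set V) {s : V} (hs : s ∉ B) :
    ∃ c ∈ T.compOff B s, ∀ u ∈ T.compOff B s, u ≠ c →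
      2 * (T.compOff (insert c B) u).ncard ≤ (T.compOff B s).ncard := by
  classical
  have := Fintype.ofFinite V
  set K := T.compOff B s
  obtain ⟨c, hc, hmin⟩ := K.toFinset.exists_min_image
    (fun c => ∑ w ∈ K.toFinset, T.dist c w) ⟨s, Set.mem_toFinset.2 (JoinedOff.refl hs)⟩
  rw [Set.mem_toFinset] at hc
  refine ⟨c, hc, fun u hu huc => ?_⟩
  set C := T.compOff (insert c B) u
  obtain ⟨q, hq⟩ : T.JoinedOff B c u := hc.symm.trans hu
  obtain ⟨p, hp, -⟩ := hT.existsUnique_path c u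
  have hpB : ∀ x ∈ p.support, x ∉ B := fun x hx => hq x (hT.support_subset_of_isPath hp q hx)
  cases p with
  | nil => exact absurd rfl huc
  | @cons _ x _ h r =>
    rw [Walk.cons_isPath_iff] at hp
    have hxK : x ∈ K := JoinedOff.trans hc
      (joinedOff_of_mem_support hpB (by simp) (by simp))
    have hCK : C ⊆ K := (compOff_anti (Set.subset_insert c B) u).trans
      (compOff_eq_of_joinedOff hu).symm.subset
    have hnear : ∀ w ∈ C, T.dist x w + 1 ≤ T.dist c w := by
      intro w hw
      have hxw : T.JoinedOff {c} x w :=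
        JoinedOff.trans ⟨r, fun z hz hzc => hp.2 (hzc ▸ hz)⟩
          (JoinedOff.anti (by simp) hw)
      obtain ⟨t, ht⟩ := hxw
      have hct : (Walk.cons h t.bypass).IsPath := by
        rw [Walk.cons_isPath_iff]
        exact ⟨t.bypass_isPath, fun hct => ht c (t.support_bypass_subset_support hct) rfl⟩
      obtain ⟨d, hd, hdl⟩ := hT.1.exists_path_of_dist c w
      rw [← hdl, hT.path_eq hd hct, Walk.length_cons]
      exact Nat.add_le_add_right (dist_le _) 1
    have hfar : ∀ w, T.dist x w ≤ T.dist c w + 1 := by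
      intro w
      have h1 := hT.1.dist_triangle (u := x) (v := c) (w := w)
      have h2 : T.dist x c = 1 := dist_eq_one_iff_adj.2 h.symm
      omega
    have hle := hmin x (by simpa using hxK)
    have hsum : ∑ w ∈ K.toFinset, (T.dist x w + if w ∈ C then 2 else 0) ≤
        ∑ w ∈ K.toFinset, (T.dist c w + 1) := by
      refine Finset.sum_le_sum fun w _ => ?_
      split_ifs with hw
      · have := hnear w hw
        omega
      · exact hfar w
    have hfilter : K.toFinset.filter (· ∈ C) = C.toFinset := by
      ext w
      simp only [Finset.mem_filter, Set.mem_toFinset]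
      exact ⟨fun h => h.2, fun h => ⟨hCK h, h⟩⟩
    rw [Finset.sum_add_distrib, Finset.sum_add_distrib, ← Finset.sum_filter, hfilter] at hsum
    simp only [Finset.sum_const, smul_eq_mul, mul_one] at hsum
    rw [Set.ncard_eq_toFinset_card' C, Set.ncard_eq_toFinset_card' K]
    omega

end Centroid

section Layering

/-- `grp` is a layering with at most `k` groups of the walks inside `S`: every path inside `S`
has at most six critical edges, and they meet each overlapping walk that leaves `S` or lies in a
group at least as high. -/
structure IsLayering (T : SimpleGraph V) (S : Set V) (k : ℕ)
    (grp : ∀ u v : V, T.Walk u v → ℕ) : Prop where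
  mem_range : ∀ (u v : V) (p : T.Walk u v), (∀ x ∈ p.support, x ∈ S) →
    1 ≤ grp u v p ∧ grp u v p ≤ k
  exists_critical : ∀ (u v : V) (p : T.Walk u v), p.IsPath → (∀ x ∈ p.support, x ∈ S) →
    ∃ E : Set (Sym2 V), E ⊆ {e | e ∈ p.edges} ∧ E.ncard ≤ 6 ∧
      ∀ (a b : V) (q : T.Walk a b),
        ((∃ x ∈ q.support, x ∉ S) ∨ grp u v p ≤ grp a b q) →
        (∃ e, e ∈ p.edges ∧ e ∈ q.edges) → ∃ e ∈ E, e ∈ q.edges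

/-- The walks inside `S` admit a layering with at most `k` groups. -/
def Layerable (T : SimpleGraph V) (S : Set V) (k : ℕ) : Prop :=
  ∃ grp, T.IsLayering S k grp

lemma Layerable.mono {S : Set V} {k l : ℕ} (h : T.Layerable S k) (hkl : k ≤ l) :
    T.Layerable S l := by
  obtain ⟨g, hg⟩ := h
  exact ⟨g, fun u v p hp => ⟨(hg.1 u v p hp).1, (hg.1 u v p hp).2.trans hkl⟩, hg.2⟩

lemma layerable_empty (k : ℕ) : T.Layerable ∅ k :=
  ⟨fun _ _ _ => 0, fun u _ p h => (h u p.start_mem_support).elim,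
    fun u _ p _ h => (h u p.start_mem_support).elim⟩

lemma compOff_eq_empty {B : Set V} {s : V} (hs : s ∈ B) : T.compOff B s = ∅ :=
  Set.eq_empty_of_forall_notMem fun _ h => h.symm.right_notMem hs

/-- Deleting one vertex `j` from a component with at most two boundary vertices costs one group. -/
lemma IsTree.layerable_of_insert (hT : T.IsTree) {B : Finset V} (hB : B.card ≤ 2) {s j : V}
    {k : ℕ}
    (h : ∀ u ∈ T.compOff B s, u ≠ j → T.Layerable (T.compOff (insert j (B : Set V)) u) k) :
    T.Layerable (T.compOff B s) (k + 1) := by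
  classical
  set S := T.compOff B s
  have hch : ∀ C : Set V, ∃ g, T.Layerable C k → T.IsLayering C k g := fun C => by
    by_cases hC : T.Layerable C k
    · exact ⟨hC.choose, fun _ => hC.choose_spec⟩
    · exact ⟨fun _ _ _ => 0, fun h => (hC h).elim⟩
  choose G hG using hch
  let B' : Set V := insert j (B : Set V)
  let grp : ∀ u v : V, T.Walk u v → ℕ := fun u v p =>
    if j ∈ p.support then k + 1 else G (T.compOff B' u) u v p
  have hSB : ∀ x ∈ S, x ∉ (B : Set V) := fun x hx => JoinedOff.right_notMem hx
  have hsub : ∀ {u v : V} (p : T.Walk u v), (∀ x ∈ p.support, x ∈ S) → j ∉ p.support →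
      T.IsLayering (T.compOff B' u) k (G (T.compOff B' u)) ∧
        ∀ x ∈ p.support, x ∈ T.compOff B' u := by
    intro u v p hp hj
    have hav : ∀ x ∈ p.support, x ∉ B' := by
      rintro x hx (rfl | hxB)
      · exact hj hx
      · exact hSB x (hp x hx) hxB
    refine ⟨hG _ (h u (hp u p.start_mem_support) ?_), fun x hx =>
      joinedOff_of_mem_support hav p.start_mem_support hx⟩
    rintro rfl
    exact hj p.start_mem_support
  refine ⟨grp, fun u v p hp => ?_, fun u v p hpath hp => ?_⟩
  · by_cases hj : j ∈ p.support
    · simp [grp, hj]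
    · obtain ⟨hl, hc⟩ := hsub p hp hj
      have := hl.mem_range u v p hc
      simp only [grp, hj, if_false]
      omega
  · by_cases hj : j ∈ p.support
    · obtain ⟨E, hE, hcard, hcrit⟩ := hT.exists_critical_edges_finset hpath (insert j B)
      have := Finset.card_insert_le j B
      refine ⟨E, hE, by omega, fun a b q hq ho => hcrit a b q ?_ ho⟩
      by_cases hqS : ∀ x ∈ q.support, x ∈ S
      · refine ⟨j, Finset.mem_insert_self _ _, ?_⟩
        by_contra hjq
        obtain ⟨hl, hc⟩ := hsub q hqS hjq
        have h1 := hl.mem_range a b q hc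
        rcases hq with ⟨x, hx, hx'⟩ | hq
        · exact hx' (hqS x hx)
        · simp only [grp, hj, hjq, if_true, if_false] at hq
          omega
      · push Not at hqS
        obtain ⟨y, hy, hyS⟩ := hqS
        obtain ⟨e, hep, heq⟩ := ho
        by_contra hno
        push Not at hno
        have hav : ∀ x ∈ q.support, x ∉ (B : Set V) := fun x hx hxB =>
          hno x (Finset.mem_insert_of_mem hxB) hx
        induction e with
        | _ α β =>
          have hα := hp α (p.fst_mem_support_of_mem_edges hep)
          exact hyS (JoinedOff.trans hα
            (joinedOff_of_mem_support hav (q.fst_mem_support_of_mem_edges heq) hy))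
    · obtain ⟨hl, hc⟩ := hsub p hp hj
      obtain ⟨E, hE, hcard, hcrit⟩ := hl.exists_critical u v p hpath hc
      refine ⟨E, hE, hcard, fun a b q hq ho => hcrit a b q ?_ ho⟩
      by_cases hqC : ∀ x ∈ q.support, x ∈ T.compOff B' u
      · right
        have hqS : ∀ x ∈ q.support, x ∈ S := fun x hx =>
          JoinedOff.trans (hp u p.start_mem_support)
            (compOff_anti (Set.subset_insert j _) u (hqC x hx))
        have hjq : j ∉ q.support := fun hjq =>
          JoinedOff.right_notMem (hqC j hjq) (Set.mem_insert j _)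
        rcases hq with ⟨x, hx, hx'⟩ | hq
        · exact (hx' (hqS x hx)).elim
        · simp only [grp, hj, hjq, if_false] at hq
          rwa [← compOff_eq_of_joinedOff (hqC a q.start_mem_support)] at hq
      · left
        push Not at hqC
        exact hqC

/-- If small components with two boundary vertices can be layered, then so can components of twice
the size with one boundary vertex. -/
lemma IsTree.layerable_of_card_le_one [Finite V] (hT : T.IsTree) {k l : ℕ}
    (h : ∀ (B : Finset V) (s : V), B.card ≤ 2 → (T.compOff B s).ncard < 2 ^ k →
      T.Layerable (T.compOff B s) l)
    (B : Finset V) (s : V) (hB : B.card ≤ 1) (hcard : (T.compOff B s).ncard < 2 ^ (k + 1)) :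
    T.Layerable (T.compOff B s) (l + 1) := by
  classical
  by_cases hs : s ∈ (B : Set V)
  · rw [compOff_eq_empty hs]
    exact layerable_empty _
  obtain ⟨c, -, hc⟩ := hT.exists_centroid_s5 (B : Set V) hs
  refine hT.layerable_of_insert (by omega) (j := c) fun u hu huc => ?_
  have hhalf := hc u hu huc
  have hins := Finset.card_insert_le c B
  rw [← Finset.coe_insert] at hhalf ⊢
  exact h _ u (by omega) (by rw [pow_succ] at hcard; omega)

lemma IsTree.layerable_of_card_le_two [Finite V] (hT : T.IsTree) (k : ℕ) :
    ∀ (B : Finset V) (s : V), B.card ≤ 2 → (T.compOff B s).ncard < 2 ^ k →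
      T.Layerable (T.compOff B s) (2 * k) := by
  classical
  induction k with
  | zero =>
    intro B s _ hcard
    rw [pow_zero, Nat.lt_one_iff, Set.ncard_eq_zero] at hcard
    rw [hcard]
    exact layerable_empty _
  | succ k ih =>
    intro B s hB hcard
    have hone := hT.layerable_of_card_le_one ih
    by_cases hB1 : B.card ≤ 1
    · exact (hone B s hB1 hcard).mono (by omega)
    by_cases hs : s ∈ (B : Set V)
    · rw [compOff_eq_empty hs]
      exact layerable_empty _
    obtain ⟨c, -, hc⟩ := hT.exists_centroid_s5 (B : Set V) hs
    obtain ⟨a, b, -, rfl⟩ := Finset.card_eq_two.1 (show B.card = 2 by omega)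
    obtain ⟨j, hab, hca, hcb⟩ := hT.exists_median a b c
    refine hT.layerable_of_insert hB (j := j) (k := 2 * k + 1) fun u hu huj => ?_
    have hle : (T.compOff (insert j (({a, b} : Finset V) : Set V)) u).ncard ≤
        (T.compOff ({a, b} : Finset V) s).ncard := by
      rw [compOff_eq_of_joinedOff hu]
      exact Set.ncard_le_ncard (compOff_anti (Set.subset_insert _ _) u)
    by_cases hcu : T.JoinedOff (insert j (({a, b} : Finset V) : Set V)) u c
    · have hcu' : T.JoinedOff {j} c u := (JoinedOff.anti (by simp) hcu).symm
      have hua : ¬ T.JoinedOff {j} u a := fun h => hca (hcu'.trans h)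
      have hub : ¬ T.JoinedOff {j} u b := fun h => hcb (hcu'.trans h)
      have heq : T.compOff (insert j (({a, b} : Finset V) : Set V)) u =
          T.compOff (({j} : Finset V) : Set V) u := by
        rw [Finset.coe_singleton, ← compOff_insert_eq hua,
          ← compOff_insert_eq (b := b) (B := insert a {j}) fun h => hub (h.anti (by simp))]
        congr 1
        ext x
        simp only [Finset.coe_insert, Finset.coe_singleton, Set.mem_insert_iff,
          Set.mem_singleton_iff]
        tauto
      rw [heq] at hle ⊢
      exact hone {j} u (by simp) (hle.trans_lt hcard)
    · have huc : u ≠ c := by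
        rintro rfl
        refine hcu (JoinedOff.refl ?_)
        rintro (h | h)
        · exact huj h
        · exact JoinedOff.right_notMem hu h
      have hsub : T.compOff (insert j (({a, b} : Finset V) : Set V)) u ⊆
          T.compOff (insert c (({a, b} : Finset V) : Set V)) u := by
        rw [← compOff_insert_eq hcu]
        exact compOff_anti (Set.insert_subset_insert (Set.subset_insert _ _)) u
      have hhalf := hc u hu huc
      have hsize := Set.ncard_le_ncard hsub
      have hlt : (T.compOff (insert j (({a, b} : Finset V) : Set V)) u).ncard < 2 ^ k := by
        rw [pow_succ] at hcard
        omega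
      have hpair : ∀ x y : V, ({a, b} : Finset V) = {x, y} → ¬ T.JoinedOff {j} u y →
          T.Layerable (T.compOff (insert j (({a, b} : Finset V) : Set V)) u) (2 * k + 1) := by
        intro x y hxy huy
        have heq : T.compOff (insert j (({a, b} : Finset V) : Set V)) u =
            T.compOff (({x, j} : Finset V) : Set V) u := by
          rw [← compOff_insert_eq (b := y) (B := (({x, j} : Finset V) : Set V))
            fun h => huy (h.anti (by simp)), hxy]
          congr 1
          ext z
          simp only [Finset.coe_insert, Finset.coe_singleton, Set.mem_insert_iff,
            Set.mem_singleton_iff]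
          tauto
        rw [heq] at hlt ⊢
        exact (ih _ u Finset.card_le_two hlt).mono (by omega)
      by_cases hua : T.JoinedOff {j} u a
      · exact hpair a b rfl fun hub => hab (hua.symm.trans hub)
      · exact hpair b a (Finset.pair_comm a b) hua

lemma IsTree.layerable_univ [Fintype V] (hT : T.IsTree) :
    T.Layerable Set.univ (2 * Nat.clog 2 (Fintype.card V) + 1) := by
  obtain ⟨s⟩ := hT.1.nonempty
  have huniv : T.compOff ((∅ : Finset V) : Set V) s = Set.univ :=
    Set.eq_univ_of_forall fun w => by
      obtain ⟨q⟩ := hT.1.preconnected s w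
      exact ⟨q, by simp⟩
  rw [← huniv]
  refine hT.layerable_of_card_le_one (hT.layerable_of_card_le_two _) ∅ s (by simp) ?_
  rw [huniv, Set.ncard_univ, Nat.card_eq_fintype_card]
  exact (Nat.le_pow_clog one_lt_two _).trans_lt (Nat.pow_lt_pow_right one_lt_two (by omega))

end Layering

end SimpleGraph

/-- Layered decomposition for trees: for every tree on `n ≥ 2` vertices there are at most
`2⌈log₂ n⌉ + 2` groups, a group index for every path, and an assignment of at most `6`
critical edges to every path, such that whenever two paths overlap and the group of the first
is at most the group of the second, the second path contains a critical edge of the first. -/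
theorem layered_decomposition_exists {V : Type*} [Fintype V] (T : SimpleGraph V)
    (hT : T.IsTree) (hn : 2 ≤ Fintype.card V) :
    ∃ (ℓ : ℕ) (grp : ∀ u v : V, T.Walk u v → ℕ)
      (π : ∀ u v : V, T.Walk u v → Set (Sym2 V)),
      ℓ ≤ 2 * Nat.clog 2 (Fintype.card V) + 2 ∧
      (∀ (u v : V) (p : T.Walk u v), p.IsPath → u ≠ v →
        1 ≤ grp u v p ∧ grp u v p ≤ ℓ ∧
        (∀ e ∈ π u v p, e ∈ p.edges) ∧ (π u v p).ncard ≤ 6) ∧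
      (∀ (u₁ v₁ u₂ v₂ : V) (p₁ : T.Walk u₁ v₁) (p₂ : T.Walk u₂ v₂),
        p₁.IsPath → u₁ ≠ v₁ → p₂.IsPath → u₂ ≠ v₂ →
        (∃ e, e ∈ p₁.edges ∧ e ∈ p₂.edges) →
        grp u₁ v₁ p₁ ≤ grp u₂ v₂ p₂ →
        ∃ e ∈ π u₁ v₁ p₁, e ∈ p₂.edges) := by
  classical
  obtain ⟨grp, hg⟩ := hT.layerable_univ
  have hcrit : ∀ (u v : V) (p : T.Walk u v), ∃ E : Set (Sym2 V), p.IsPath →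
      E ⊆ {e | e ∈ p.edges} ∧ E.ncard ≤ 6 ∧
        ∀ (a b : V) (q : T.Walk a b), grp u v p ≤ grp a b q →
          (∃ e, e ∈ p.edges ∧ e ∈ q.edges) → ∃ e ∈ E, e ∈ q.edges := by
    intro u v p
    by_cases hp : p.IsPath
    · obtain ⟨E, hE, hc, h⟩ := hg.exists_critical u v p hp fun _ _ => Set.mem_univ _
      exact ⟨E, fun _ => ⟨hE, hc, fun a b q hq => h a b q (Or.inr hq)⟩⟩
    · exact ⟨∅, fun h => absurd h hp⟩
  choose π hπ using hcrit
  refine ⟨2 * Nat.clog 2 (Fintype.card V) + 1, grp, π, Nat.le_succ _, fun u v p hp _ => ?_,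
    fun u₁ v₁ u₂ v₂ p₁ p₂ h₁ _ _ _ ho hle => (hπ u₁ v₁ p₁ h₁).2.2 u₂ v₂ p₂ hle ho⟩
  obtain ⟨h1, h2⟩ := hg.mem_range u v p fun _ _ => Set.mem_univ _
  exact ⟨h1, h2, fun e he => (hπ u v p hp).1 he, (hπ u v p hp).2.1⟩
end

section
/- Let T be a tree rooted at an arbitrary vertex g, and for a path P in T let μ(P) denote the unique vertex of minimum depth on P. Let P₁ and P₂ be overlapping paths in T such that μ(P₂) = μ(P₁) or μ(P₂) is an ancestor of μ(P₁). Then P₂ contains an edge of P₁ incident to μ(P₁). -/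
open SimpleGraph

/-- In an acyclic graph, a path uses only vertices and edges of any walk visiting both its ends. -/
theorem SimpleGraph.IsAcyclic.subset_of_isPath {V : Type*} {G : SimpleGraph V} (hG : G.IsAcyclic)
    {u v a b : V} (p : G.Walk u v) (ha : a ∈ p.support) (hb : b ∈ p.support)
    {q : G.Walk a b} (hq : q.IsPath) : q.support ⊆ p.support ∧ q.edges ⊆ p.edges := by
  classical
  let r := (p.takeUntil a ha).reverse.append (p.takeUntil b hb)
  have hr : q = r.bypass :=
    congrArg Subtype.val ((hG.subsingleton_path a b).elim ⟨q, hq⟩ ⟨r.bypass, r.bypass_isPath⟩)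
  subst hr
  refine ⟨fun w hw => ?_, fun e he => ?_⟩
  · have hw' := r.support_bypass_subset_support hw
    simp only [r, Walk.mem_support_append_iff, Walk.support_reverse, List.mem_reverse] at hw'
    exact hw'.elim (fun h => p.support_takeUntil_subset_support ha h)
      (fun h => p.support_takeUntil_subset_support hb h)
  · have he' := r.edges_bypass_subset_edges he
    simp only [r, Walk.edges_append, Walk.edges_reverse, List.mem_append, List.mem_reverse] at he'
    exact he'.elim (fun h => p.edges_takeUntil_subset_edges ha h)
      (fun h => p.edges_takeUntil_subset_edges hb h)

/-- Two paths that meet only at their common end concatenate to a path. -/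
theorem SimpleGraph.Walk.IsPath.append_of_inter_support {V : Type*} {G : SimpleGraph V}
    {u v w : V} {p : G.Walk u v} {q : G.Walk v w} (hp : p.IsPath) (hq : q.IsPath)
    (h : ∀ x ∈ p.support, x ∈ q.support → x = v) : (p.append q).IsPath := by
  have hq' := hq.support_nodup
  rw [← q.cons_tail_support, List.nodup_cons] at hq'
  rw [Walk.isPath_def, Walk.support_append, List.nodup_append']
  refine ⟨hp.support_nodup, hq'.2, fun x hx hxq => ?_⟩
  obtain rfl := h x hx (List.mem_of_mem_tail hxq)
  exact hq'.1 hxq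

/-- A vertex of a geodesic that is at least as far from the start as the end is the end. -/
theorem SimpleGraph.Walk.eq_end_of_dist_le {V : Type*} {G : SimpleGraph V} {u v w : V}
    {p : G.Walk u v} (hp : p.length = G.dist u v) (hw : w ∈ p.support)
    (h : G.dist u v ≤ G.dist u w) : w = v := by
  classical
  have hlen := congrArg Walk.length (p.take_spec hw)
  rw [Walk.length_append] at hlen
  have hle := dist_le (p.takeUntil w hw)
  exact Walk.eq_of_length_eq_zero (p := p.dropUntil w hw) (by lia)

/-- If `m` is the minimum depth vertex of the walk `p₁`, the walk `p₂` visits a vertex `m₂` on the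
path from the root to `m`, and both walks visit `x ≠ m`, then `p₁` and `p₂` share an edge at `m`. -/
theorem exists_common_edge_at_min_depth {V : Type*} {T : SimpleGraph V} (hT : T.IsTree) {g : V}
    {u₁ v₁ u₂ v₂ : V} {p₁ : T.Walk u₁ v₁} {p₂ : T.Walk u₂ v₂} {m m₂ x : V}
    (hm : IsMinDepthVertex T g p₁ m) (hm₂ : m₂ ∈ p₂.support) (hanc : OnPath T g m m₂)
    (hx₁ : x ∈ p₁.support) (hx₂ : x ∈ p₂.support) (hxm : x ≠ m) :
    ∃ e ∈ p₁.edges, m ∈ e ∧ e ∈ p₂.edges := by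
  classical
  obtain ⟨s, hs, hslen⟩ := hT.connected.exists_path_of_dist g m
  obtain ⟨q, hq, -⟩ := hT.connected.exists_path_of_dist m x
  have hms := hanc s hs
  have hqp₁ := hT.isAcyclic.subset_of_isPath p₁ hm.1 hx₁ hq
  have hpath : ((s.dropUntil m₂ hms).append q).IsPath :=
    (hs.dropUntil hms).append_of_inter_support hq fun w hws hwq =>
      Walk.eq_end_of_dist_le hslen (s.support_dropUntil_subset_support hms hws)
        (Nat.le_of_succ_le_succ (hm.2 w (hqp₁.1 hwq)))
  have hqp₂ := (hT.isAcyclic.subset_of_isPath p₂ hm₂ hx₂ hpath).2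
  have hfirst := q.mk_start_snd_mem_edges (Walk.not_nil_of_ne hxm.symm)
  refine ⟨s(m, q.snd), hqp₁.2 hfirst, Sym2.mem_mk_left _ _, hqp₂ ?_⟩
  rw [Walk.edges_append]
  exact List.mem_append_right _ hfirst

/-- If two paths of a rooted tree overlap and the capture vertex `μ(P₂)` equals `μ(P₁)` or is
an ancestor of it, then `P₂` contains an edge of `P₁` incident to `μ(P₁)`. -/
theorem overlapping_at_capture_vertex {V : Type*} (T : SimpleGraph V) (hT : T.IsTree) (g : V)
    {u₁ v₁ u₂ v₂ : V} (p₁ : T.Walk u₁ v₁) (p₂ : T.Walk u₂ v₂)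
    (hp₁ : p₁.IsPath) (h₁ : u₁ ≠ v₁) (hp₂ : p₂.IsPath) (h₂ : u₂ ≠ v₂)
    (hov : ∃ e, e ∈ p₁.edges ∧ e ∈ p₂.edges)
    (m₁ m₂ : V) (hm₁ : IsMinDepthVertex T g p₁ m₁) (hm₂ : IsMinDepthVertex T g p₂ m₂)
    (hcap : m₂ = m₁ ∨ IsAncestor T g m₂ m₁) :
    ∃ e ∈ p₁.edges, m₁ ∈ e ∧ e ∈ p₂.edges := by
  obtain ⟨⟨x, y⟩, he₁, he₂⟩ := hov
  have hanc : OnPath T g m₁ m₂ := by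
    rcases hcap with rfl | h
    · exact fun p _ => p.end_mem_support
    · exact h.2
  by_cases hx : x = m₁
  · have hy : y ≠ m₁ := fun hy => (p₁.adj_of_mem_edges he₁).ne (hx.trans hy.symm)
    exact exists_common_edge_at_min_depth hT hm₁ hm₂.1 hanc
      (p₁.snd_mem_support_of_mem_edges he₁) (p₂.snd_mem_support_of_mem_edges he₂) hy
  · exact exists_common_edge_at_min_depth hT hm₁ hm₂.1 hanc
      (p₁.fst_mem_support_of_mem_edges he₁) (p₂.fst_mem_support_of_mem_edges he₂) hx
end

section
/- Let T be a tree, let P₁ be a path in T, let u be a vertex of T not on P₁, and let y be the bending point of P₁ with respect to u, i.e., the unique vertex of P₁ such that the path in T from u to y contains no vertex of P₁ other than y. If P₂ is a path in T that contains u and shares an edge with P₁, then P₂ contains y, and moreover P₂ contains an edge of P₁ incident to y. -/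
open SimpleGraph

/-- Any two vertices of a path are joined by a path contained in it. -/
theorem SimpleGraph.Walk.IsPath.exists_isPath_edges_subset {V : Type*} {G : SimpleGraph V}
    {a b x y : V} {p : G.Walk a b} (hp : p.IsPath) (hx : x ∈ p.support) (hy : y ∈ p.support) :
    ∃ q : G.Walk x y, q.IsPath ∧ q.support ⊆ p.support ∧ q.edges ⊆ p.edges := by
  classical
  rw [← p.take_spec hx, Walk.mem_support_append_iff] at hy
  rcases hy with hy | hy
  · refine ⟨((p.takeUntil x hx).dropUntil y hy).reverse, ((hp.takeUntil hx).dropUntil hy).reverse,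
      fun z hz ↦ ?_, fun e he ↦ ?_⟩
    · rw [Walk.support_reverse, List.mem_reverse] at hz
      exact p.support_takeUntil_subset_support hx (Walk.support_dropUntil_subset_support _ hy hz)
    · rw [Walk.edges_reverse, List.mem_reverse] at he
      exact p.edges_takeUntil_subset_edges hx (Walk.edges_dropUntil_subset_edges _ hy he)
  · exact ⟨(p.dropUntil x hx).takeUntil y hy, (hp.dropUntil hx).takeUntil hy,
      fun z hz ↦ p.support_dropUntil_subset_support hx
        (Walk.support_takeUntil_subset_support _ hy hz),
      fun e he ↦ p.edges_dropUntil_subset_edges hx (Walk.edges_takeUntil_subset_edges _ hy he)⟩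

/-- If `y` is the bending point of a path `P₁` with respect to a vertex `u` not on `P₁`, then
any path `P₂` through `u` sharing an edge with `P₁` contains `y`, and moreover contains an
edge of `P₁` incident to `y`. -/
theorem bending_point_wings {V : Type*} (T : SimpleGraph V) (hT : T.IsTree)
    {a b : V} (p₁ : T.Walk a b) (hp₁ : p₁.IsPath) (hab : a ≠ b)
    (u : V) (hu : u ∉ p₁.support) (y : V)
    (hy : y ∈ p₁.support ∧
      ∀ q : T.Walk u y, q.IsPath → ∀ w ∈ q.support, w ∈ p₁.support → w = y)
    {c d : V} (p₂ : T.Walk c d) (hp₂ : p₂.IsPath) (hcd : c ≠ d)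
    (hu₂ : u ∈ p₂.support) (hov : ∃ e, e ∈ p₁.edges ∧ e ∈ p₂.edges) :
    y ∈ p₂.support ∧ ∃ e ∈ p₁.edges, y ∈ e ∧ e ∈ p₂.edges := by
  obtain ⟨hy₁, hbend⟩ := hy
  obtain ⟨z, hzy, hz₁, hz₂⟩ : ∃ z, z ≠ y ∧ z ∈ p₁.support ∧ z ∈ p₂.support := by
    obtain ⟨e, he₁, he₂⟩ := hov
    induction e with | _ v w
    have hvw : v ≠ w := (p₁.adj_of_mem_edges he₁).ne
    by_cases hv : v = y
    · exact ⟨w, hv ▸ hvw.symm, p₁.snd_mem_support_of_mem_edges he₁,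
        p₂.snd_mem_support_of_mem_edges he₂⟩
    · exact ⟨v, hv, p₁.fst_mem_support_of_mem_edges he₁, p₂.fst_mem_support_of_mem_edges he₂⟩
  obtain ⟨q, hq, -⟩ := hT.existsUnique_path u y
  obtain ⟨s, hs, hs_supp, hs_edges⟩ := hp₁.exists_isPath_edges_subset hy₁ hz₁
  obtain ⟨r, hr, -, hr_edges⟩ := hp₂.exists_isPath_edges_subset hu₂ hz₂
  cases s with
  | nil => exact absurd rfl hzy
  | @cons _ x _ hadj s =>
    have hqs : (q.append (s.cons hadj)).IsPath := by
      rw [Walk.isPath_def, Walk.support_append, List.nodup_append']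
      refine ⟨hq.support_nodup, hs.support_nodup.tail, fun w hwq hws ↦ ?_⟩
      obtain rfl := hbend q hq w hwq (hs_supp (List.mem_of_mem_tail hws))
      exact ((Walk.cons_isPath_iff _ _).1 hs).2 hws
    have hqr : q.append (s.cons hadj) = r := (hT.existsUnique_path u z).unique hqs hr
    have hmem : s(y, x) ∈ p₂.edges := hr_edges (by simp [← hqr])
    exact ⟨p₂.fst_mem_support_of_mem_edges hmem, s(y, x), hs_edges (by simp), by simp, hmem⟩
end

section
/- Let s₁ ≤ e₁ and s₂ ≤ e₂ be integers. If the integer intervals [s₁, e₁] and [s₂, e₂] have a common point and 2·(e₂ − s₂ + 1) ≥ e₁ − s₁ + 1, then at least one of the three points s₁, ⌊(s₁ + e₁)/2⌋, e₁ lies in [s₂, e₂]. -/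
/-- If two integer intervals `[s₁, e₁]` and `[s₂, e₂]` intersect and the length of the second
is at least half the length of the first, then one of the three critical points
`s₁`, `⌊(s₁+e₁)/2⌋`, `e₁` lies in `[s₂, e₂]`. -/
theorem interval_critical_points (s₁ e₁ s₂ e₂ : ℤ) (h₁ : s₁ ≤ e₁) (h₂ : s₂ ≤ e₂)
    (hcommon : ∃ x : ℤ, s₁ ≤ x ∧ x ≤ e₁ ∧ s₂ ≤ x ∧ x ≤ e₂)
    (hlen : 2 * (e₂ - s₂ + 1) ≥ e₁ - s₁ + 1) :
    (s₂ ≤ s₁ ∧ s₁ ≤ e₂) ∨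
    (s₂ ≤ (s₁ + e₁) / 2 ∧ (s₁ + e₁) / 2 ≤ e₂) ∨
    (s₂ ≤ e₁ ∧ e₁ ≤ e₂) := by
  obtain ⟨x, hx⟩ := hcommon
  omega
end

section
/- Let R be a finite set, let t : R → ℕ, let δ : R → ℝ with δ(d) ≥ 0 for all d ∈ R, let p : R → ℝ, and let 'conflict' be a symmetric and reflexive binary relation on R. For d ∈ R define pred(d) = {d′ ∈ R : d′ conflicts with d and t(d′) ≤ t(d)} and succ(d) = {d′ ∈ R : d′ conflicts with d and t(d) ≤ t(d′)}. Suppose S ⊆ R satisfies: (i) for every d ∈ S, p(d) ≥ Σ_{d′ ∈ pred(d)} δ(d′); and (ii) for every d′ ∈ R, succ(d′) ∩ S ≠ ∅. Then Σ_{d ∈ S} p(d) ≥ Σ_{d′ ∈ R} δ(d′). -/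
/-- The core counting inequality of the two-phase primal–dual framework: if every element of
the solution `S` has profit at least the total raise of its predecessors, and every raised
element has a successor in `S`, then the profit of `S` is at least the total raise. -/
theorem two_phase_counting {α : Type*} [DecidableEq α] (R : Finset α)
    (t : α → ℕ) (δ : α → ℝ) (p : α → ℝ)
    (conflict : α → α → Prop) [DecidableRel conflict]
    (hsymm : Symmetric conflict) (hrefl : Reflexive conflict)
    (hδ : ∀ d ∈ R, 0 ≤ δ d)
    (S : Finset α) (hS : S ⊆ R)
    (hpred : ∀ d ∈ S,
      (∑ d' ∈ R.filter fun d' => conflict d' d ∧ t d' ≤ t d, δ d') ≤ p d)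
    (hsucc : ∀ d' ∈ R,
      ((R.filter fun d => conflict d' d ∧ t d' ≤ t d) ∩ S).Nonempty) :
    (∑ d' ∈ R, δ d') ≤ ∑ d ∈ S, p d := by
  calc ∑ d' ∈ R, δ d'
      ≤ ∑ d' ∈ R, ∑ d ∈ S with conflict d' d ∧ t d' ≤ t d, δ d' := by
        refine Finset.sum_le_sum fun d' hd' => ?_
        obtain ⟨d, hd⟩ := hsucc d' hd'
        rw [Finset.mem_inter, Finset.mem_filter] at hd
        exact Finset.single_le_sum (f := fun _ => δ d') (fun _ _ => hδ d' hd')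
          (Finset.mem_filter.mpr ⟨hd.2, hd.1.2⟩)
    _ = ∑ d ∈ S, ∑ d' ∈ R with conflict d' d ∧ t d' ≤ t d, δ d' := by
        refine Finset.sum_comm' fun d' d => ?_
        simp only [Finset.mem_filter]
        tauto
    _ ≤ ∑ d ∈ S, p d := Finset.sum_le_sum hpred
end
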